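/- arXiv:2107.01741 — 3 statements merged into one kernel-verified Lean document; each statement's English description precedes it below -/
import Mathlib

section
/- Let p ∈ [p_c, ∞], γ ∈ ℝ, 0 < ν < μ < ∞, and let g : (0,∞) → (0,∞) satisfy g(t) → ∞ and g(t)/t^{α/(2β)} → 0 as t → ∞. Suppose ‖f(·,t)‖_{L^1(ℝ^N)} ≤ C₀ (1+t)^{−γ} for all t ≥ 0 and that there are R₀, C₁ > 0 with |f(x,t)| ≤ C₁ |x|^{−N} (1+t)^{−γ} for all |x| ≥ R₀ and t ≥ 0. Then there are C > 0 and t₀ ≥ 2 such that the mild solution u satisfies, for all t ≥ t₀: ‖u(·,t)‖_{L^p({ν ≤ |x|/g(t) ≤ μ})} ≤ C g(t)^{2β−N(1−1/p)} t^{−γ} if γ < 1; ≤ C g(t)^{2β−N(1−1/p)} max{t^{−1}, t^{−(1+α)} g(t)^{2β} log t} if γ = 1; and ≤ C g(t)^{2β−N(1−1/p)} max{t^{−γ}, t^{−(1+α)} g(t)^{2β}} if γ > 1. -/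
open MeasureTheory Real Set Filter
open scoped ENNReal Pointwise

/-- the majorant of the kernel -/
noncomputable def wk (n α β r τ : ℝ) : ℝ :=
  min (τ ^ (-1 - α) * r ^ (4 * β - n)) (τ ^ (2 * α - 1) * r ^ (-(n + 2 * β)))

lemma wk_nonneg (n α β r τ : ℝ) (hr : 0 ≤ r) (hτ : 0 ≤ τ) : 0 ≤ wk n α β r τ := by
  unfold wk
  exact le_min (by positivity) (by positivity)

lemma wk_anti {n α β r r' τ : ℝ} (hn : 4 * β < n) (hβ : 0 < β) (hr : 0 < r) (hrr : r ≤ r')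
    (hτ : 0 ≤ τ) : wk n α β r' τ ≤ wk n α β r τ := by
  unfold wk
  refine min_le_min ?_ ?_
  · exact mul_le_mul_of_nonneg_left (rpow_le_rpow_of_nonpos hr hrr (by linarith)) (by positivity)
  · exact mul_le_mul_of_nonneg_left (rpow_le_rpow_of_nonpos hr hrr (by linarith)) (by positivity)

lemma rescale {n α β r τ e d : ℝ} (hβ : 0 < β) (hr : 0 < r) (hτ : 0 < τ)
    (hd : α - 1 - α * n / (2 * β) + (-(α / (2 * β))) * e = d) :
    τ ^ (α - 1 - α * n / (2 * β)) * (τ ^ (-(α / (2 * β))) * r) ^ e = τ ^ d * r ^ e := by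
  rw [mul_rpow (by positivity) hr.le, ← rpow_mul hτ.le, ← mul_assoc, ← rpow_add hτ, hd]

lemma Y_bound (N : ℕ) (α β : ℝ) (hβ : 0 < β)
    (G : EuclideanSpace ℝ (Fin N) → ℝ)
    (c₂ : ℝ) (hc₂ : 0 < c₂)
    (hGin : ∀ ξ : EuclideanSpace ℝ (Fin N), 0 < ‖ξ‖ → ‖ξ‖ ≤ 1 →
      G ξ ≤ c₂ * ‖ξ‖ ^ (4 * β - (N : ℝ)))
    (hGout : ∀ ξ : EuclideanSpace ℝ (Fin N), 1 ≤ ‖ξ‖ →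
      G ξ ≤ c₂ * ‖ξ‖ ^ (-((N : ℝ) + 2 * β)))
    (z : EuclideanSpace ℝ (Fin N)) (hz : z ≠ 0) (τ : ℝ) (hτ : 0 < τ) :
    τ ^ (α - 1 - α * (N : ℝ) / (2 * β)) * G ((τ ^ (-(α / (2 * β)))) • z)
      ≤ c₂ * wk N α β ‖z‖ τ := by
  have hz' : 0 < ‖z‖ := norm_pos_iff.2 hz
  have hn : ‖(τ ^ (-(α / (2 * β)))) • z‖ = τ ^ (-(α / (2 * β))) * ‖z‖ := by
    rw [norm_smul, Real.norm_of_nonneg (by positivity)]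
  have key : ∀ ξ : EuclideanSpace ℝ (Fin N), 0 < ‖ξ‖ →
      G ξ ≤ c₂ * ‖ξ‖ ^ (4 * β - (N : ℝ)) ∧ G ξ ≤ c₂ * ‖ξ‖ ^ (-((N : ℝ) + 2 * β)) := by
    intro ξ hξ
    rcases le_total ‖ξ‖ 1 with h | h
    · refine ⟨hGin ξ hξ h, (hGin ξ hξ h).trans ?_⟩
      exact mul_le_mul_of_nonneg_left (rpow_le_rpow_of_exponent_ge hξ h (by linarith)) hc₂.le
    · refine ⟨(hGout ξ h).trans ?_, hGout ξ h⟩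
      exact mul_le_mul_of_nonneg_left (rpow_le_rpow_of_exponent_le h (by linarith)) hc₂.le
  obtain ⟨h1, h2⟩ := key ((τ ^ (-(α / (2 * β)))) • z) (by rw [hn]; positivity)
  rw [hn] at h1 h2
  have hp : 0 ≤ τ ^ (α - 1 - α * (N : ℝ) / (2 * β)) := by positivity
  unfold wk
  rw [mul_min_of_nonneg _ _ hc₂.le]
  refine le_min ?_ ?_
  · rw [← rescale (n := N) (α := α) hβ hz' hτ (e := 4 * β - N) (by field_simp; ring)]
    calc _ ≤ _ := mul_le_mul_of_nonneg_left h1 hp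
      _ = _ := by ring
  · rw [← rescale (n := N) (α := α) hβ hz' hτ (e := -(N + 2 * β)) (by field_simp; ring)]
    calc _ ≤ _ := mul_le_mul_of_nonneg_left h2 hp
      _ = _ := by ring

lemma lint_small {a T : ℝ} (ha : -1 < a) (hT : 0 ≤ T) :
    ∫⁻ τ in Ioc 0 T, ENNReal.ofReal (τ ^ a) = ENNReal.ofReal (T ^ (a + 1) / (a + 1)) := by
  rw [← ofReal_integral_eq_lintegral_ofReal]
  · rw [← intervalIntegral.integral_of_le hT, integral_rpow (Or.inl ha), zero_rpow (by linarith),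
      sub_zero]
  · exact (intervalIntegrable_iff_integrableOn_Ioc_of_le hT).1
      (intervalIntegral.intervalIntegrable_rpow' ha)
  · filter_upwards [ae_restrict_mem measurableSet_Ioc] with x hx
    exact rpow_nonneg hx.1.le _

lemma lint_large {a T : ℝ} (ha : a < -1) (hT : 0 < T) :
    ∫⁻ τ in Ioi T, ENNReal.ofReal (τ ^ a) = ENNReal.ofReal (-T ^ (a + 1) / (a + 1)) := by
  rw [← ofReal_integral_eq_lintegral_ofReal]
  · rw [integral_Ioi_rpow_of_lt ha hT]
  · exact integrableOn_Ioi_rpow_of_lt ha hT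
  · filter_upwards [ae_restrict_mem measurableSet_Ioi] with x hx
    exact rpow_nonneg (hT.trans hx).le _

lemma wk_time {n α β r : ℝ} (hα : 0 < α) (hr : 0 < r) :
    ∫⁻ τ in Ioi 0, ENNReal.ofReal (wk n α β r τ) ≤
      ENNReal.ofReal ((1 / (2 * α) + 1 / α) * r ^ (2 * β - n)) := by
  set T := r ^ (2 * β / α) with hTdef
  have hT : 0 < T := by positivity
  have hU : Ioi (0 : ℝ) = Ioc 0 T ∪ Ioi T := (Ioc_union_Ioi_eq_Ioi hT.le).symm
  rw [hU]
  refine (lintegral_union_le _ _ _).trans ?_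
  have h1 : ∫⁻ τ in Ioc 0 T, ENNReal.ofReal (wk n α β r τ) ≤
      ENNReal.ofReal (1 / (2 * α) * r ^ (2 * β - n)) := by
    calc _ ≤ ∫⁻ τ in Ioc 0 T, ENNReal.ofReal (τ ^ (2 * α - 1)) * ENNReal.ofReal (r ^ (-(n + 2 * β))) := by
          refine setLIntegral_mono' measurableSet_Ioc fun τ hτ => ?_
          rw [← ENNReal.ofReal_mul (rpow_nonneg hτ.1.le _)]
          exact ENNReal.ofReal_le_ofReal (min_le_right _ _)
      _ = _ := by
          rw [lintegral_mul_const' _ _ ENNReal.ofReal_ne_top, lint_small (by linarith) hT.le,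
            ← ENNReal.ofReal_mul (by ring_nf; positivity)]
          congr 1
          rw [hTdef, ← rpow_mul hr.le, show 2 * β / α * (2 * α - 1 + 1) = 4 * β by field_simp; ring,
            show 2 * α - 1 + 1 = 2 * α by ring, div_mul_eq_mul_div, ← rpow_add hr]
          rw [show 4 * β + -(n + 2 * β) = 2 * β - n by ring]; ring
  have h2 : ∫⁻ τ in Ioi T, ENNReal.ofReal (wk n α β r τ) ≤
      ENNReal.ofReal (1 / α * r ^ (2 * β - n)) := by
    calc _ ≤ ∫⁻ τ in Ioi T, ENNReal.ofReal (τ ^ (-1 - α)) * ENNReal.ofReal (r ^ (4 * β - n)) := by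
          refine setLIntegral_mono' measurableSet_Ioi fun τ hτ => ?_
          rw [← ENNReal.ofReal_mul (rpow_nonneg (hT.trans hτ).le _)]
          exact ENNReal.ofReal_le_ofReal (min_le_left _ _)
      _ = _ := by
          rw [lintegral_mul_const' _ _ ENNReal.ofReal_ne_top, lint_large (by linarith) hT,
            ← ENNReal.ofReal_mul (by
              rw [show -1 - α + 1 = -α by ring, neg_div_neg_eq]; positivity)]
          congr 1
          rw [show -1 - α + 1 = -α by ring, neg_div_neg_eq, hTdef, ← rpow_mul hr.le,
            show 2 * β / α * (-α) = -(2 * β) by field_simp,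
            div_mul_eq_mul_div, ← rpow_add hr]
          rw [show -(2 * β) + (4 * β - n) = 2 * β - n by ring]; ring
  refine (add_le_add h1 h2).trans ?_
  rw [← ENNReal.ofReal_add (by positivity) (by positivity)]
  apply le_of_eq; congr 1; ring

lemma space_int (N : ℕ) (hN : 0 < N) (a : ℝ) (ha : 0 < a) :
    ∃ K : ℝ, 0 ≤ K ∧ ∀ B : ℝ, 0 < B →
      ∫⁻ z in Metric.ball (0 : EuclideanSpace ℝ (Fin N)) B, ENNReal.ofReal (‖z‖ ^ (a - N)) ≤
        ENNReal.ofReal (K * B ^ a) := by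
  have : Nontrivial (EuclideanSpace ℝ (Fin N)) := by
    apply Module.nontrivial_of_finrank_pos (R := ℝ); simpa using hN
  refine ⟨∫ z in Metric.ball (0 : EuclideanSpace ℝ (Fin N)) 1, ‖z‖ ^ (a - N), ?_, ?_⟩
  · exact integral_nonneg fun z => by positivity
  · intro B hB
    rw [← ofReal_integral_eq_lintegral_ofReal]
    · apply le_of_eq; congr 1
      have := Measure.setIntegral_comp_smul_of_pos (volume : Measure (EuclideanSpace ℝ (Fin N)))
        (fun z => ‖z‖ ^ (a - N)) (Metric.ball 0 1) hB
      rw [smul_unitBall hB.ne', Real.norm_of_nonneg hB.le] at this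
      simp only [norm_smul, Real.norm_of_nonneg hB.le, finrank_euclideanSpace, Fintype.card_fin,
        smul_eq_mul] at this
      simp only [mul_rpow hB.le (norm_nonneg _)] at this
      rw [integral_const_mul] at this
      have hBN : (0:ℝ) < B ^ N := by positivity
      rw [inv_mul_eq_div, eq_div_iff hBN.ne'] at this
      rw [← this]
      have h3 : B ^ a = B ^ (a - N) * B ^ N := by
        rw [← rpow_natCast B N, ← rpow_add hB]; simp
      rw [h3]; ring
    · refine (integrableOn_fun_norm_addHaar (volume : Measure (EuclideanSpace ℝ (Fin N))) (f := fun y => y ^ (a - N))).2 ?_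
      have h1 : IntegrableOn (fun y : ℝ => y ^ (a - 1)) (Ioo 0 B) :=
        ((intervalIntegrable_iff_integrableOn_Ioo_of_le hB.le).1
          (intervalIntegral.intervalIntegrable_rpow' (by linarith)))
      refine h1.congr_fun (fun y hy => ?_) measurableSet_Ioo
      simp only [finrank_euclideanSpace, Fintype.card_fin, smul_eq_mul]
      rw [← rpow_natCast y (N-1), ← rpow_add hy.1, Nat.cast_sub hN]
      congr 1; push_cast; ring
    · exact Eventually.of_forall fun z => by positivity

lemma wk_meas (N : ℕ) (α β : ℝ) : Measurable (fun q : EuclideanSpace ℝ (Fin N) × ℝ =>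
    ENNReal.ofReal (wk N α β ‖q.1‖ q.2)) := by
  unfold wk
  fun_prop

/-- spatial integral of the majorant on a ball -/
noncomputable def Hk (N : ℕ) (α β B τ : ℝ) : ℝ≥0∞ :=
  ∫⁻ z in Metric.ball (0 : EuclideanSpace ℝ (Fin N)) B, ENNReal.ofReal (wk N α β ‖z‖ τ)

lemma Hk_bounds (N : ℕ) (α β : ℝ) (hN : 0 < N) (hα : 0 < α) (hβ : 0 < β) :
    ∃ K : ℝ, 0 ≤ K ∧ ∀ B : ℝ, 0 < B →
      (∀ τ, 0 < τ → Hk N α β B τ ≤ ENNReal.ofReal (K * B ^ (4 * β) * τ ^ (-1 - α))) ∧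
      ∫⁻ τ in Ioi 0, Hk N α β B τ ≤ ENNReal.ofReal (K * B ^ (2 * β)) := by
  obtain ⟨K4, hK4, h4⟩ := space_int N hN (4 * β) (by positivity)
  obtain ⟨K2, hK2, h2⟩ := space_int N hN (2 * β) (by positivity)
  have : Nontrivial (EuclideanSpace ℝ (Fin N)) := by
    apply Module.nontrivial_of_finrank_pos (R := ℝ); simpa using hN
  refine ⟨K4 + (1 / (2 * α) + 1 / α) * K2, by positivity, fun B hB => ⟨fun τ hτ => ?_, ?_⟩⟩
  · calc Hk N α β B τ ≤ ∫⁻ z in Metric.ball (0 : EuclideanSpace ℝ (Fin N)) B,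
          ENNReal.ofReal (τ ^ (-1 - α)) * ENNReal.ofReal (‖z‖ ^ (4 * β - N)) := by
          refine lintegral_mono fun z => ?_
          rw [← ENNReal.ofReal_mul (by positivity)]
          exact ENNReal.ofReal_le_ofReal (min_le_left _ _)
      _ ≤ ENNReal.ofReal (τ ^ (-1 - α)) * ENNReal.ofReal (K4 * B ^ (4 * β)) := by
          rw [lintegral_const_mul' _ _ ENNReal.ofReal_ne_top]
          gcongr
          exact h4 B hB
      _ ≤ _ := by
          rw [← ENNReal.ofReal_mul (by positivity)]
          apply ENNReal.ofReal_le_ofReal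
          rw [mul_comm]
          gcongr
          have : 0 ≤ (1 / (2 * α) + 1 / α) * K2 := by positivity
          linarith
  · unfold Hk
    rw [lintegral_lintegral_swap (by
      have := (wk_meas N α β).comp measurable_swap
      exact this.aemeasurable)]
    calc _ ≤ ∫⁻ z in Metric.ball (0 : EuclideanSpace ℝ (Fin N)) B,
          ENNReal.ofReal (1 / (2 * α) + 1 / α) * ENNReal.ofReal (‖z‖ ^ (2 * β - N)) := by
          refine lintegral_mono_ae ?_
          have h0 : ∀ᵐ z : EuclideanSpace ℝ (Fin N) ∂volume, z ≠ 0 := by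
            simp [ae_iff]
          filter_upwards [ae_restrict_of_ae h0] with z hz
          rw [← ENNReal.ofReal_mul (by positivity)]
          exact wk_time hα (norm_pos_iff.2 hz)
      _ ≤ ENNReal.ofReal (1 / (2 * α) + 1 / α) * ENNReal.ofReal (K2 * B ^ (2 * β)) := by
          rw [lintegral_const_mul' _ _ ENNReal.ofReal_ne_top]
          gcongr
          exact h2 B hB
      _ ≤ _ := by
          rw [← ENNReal.ofReal_mul (by positivity)]
          apply ENNReal.ofReal_le_ofReal
          rw [← mul_assoc]
          gcongr
          linarith

lemma weight_le {γ s t : ℝ} (ht : 1 ≤ t) (hs : t / 2 < s) (hst : s < t) :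
    (1 + s) ^ (-γ) ≤ 2 ^ |γ| * t ^ (-γ) := by
  rcases le_total 0 γ with h | h
  · rw [abs_of_nonneg h]
    calc (1 + s) ^ (-γ) ≤ (t / 2) ^ (-γ) :=
          rpow_le_rpow_of_nonpos (by linarith) (by linarith) (by linarith)
      _ = _ := by
          rw [div_rpow (by linarith) (by norm_num), rpow_neg (by norm_num : (0:ℝ) ≤ 2)]
          field_simp
  · rw [abs_of_nonpos h, ← mul_rpow (by norm_num) (by linarith)]
    exact rpow_le_rpow (by linarith) (by linarith) (by linarith)

lemma weight_intble (γ t : ℝ) (ht : 0 ≤ t) :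
    IntervalIntegrable (fun s : ℝ => (1 + s) ^ (-γ)) volume 0 t := by
  apply ContinuousOn.intervalIntegrable
  rw [uIcc_of_le ht]
  refine ContinuousOn.rpow_const (by fun_prop) fun s hs => Or.inl ?_
  have := hs.1
  linarith

lemma time_lemma {α γ t K1 K2 : ℝ} (hα : 0 < α) (ht : 1 ≤ t) (hK1 : 0 ≤ K1) (hK2 : 0 ≤ K2)
    (Φ : ℝ → ℝ≥0∞) (h1 : ∀ τ, 0 < τ → Φ τ ≤ ENNReal.ofReal (K1 * τ ^ (-1 - α)))
    (h2 : ∫⁻ τ in Ioi 0, Φ τ ≤ ENNReal.ofReal K2) :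
    ∫⁻ s in Ioo 0 t, ENNReal.ofReal ((1 + s) ^ (-γ)) * Φ (t - s) ≤
      ENNReal.ofReal (K1 * (t / 2) ^ (-1 - α) * (∫ s in (0:ℝ)..t, (1 + s) ^ (-γ))
        + 2 ^ |γ| * t ^ (-γ) * K2) := by
  have hsub : Ioo 0 t = Ioc 0 (t / 2) ∪ Ioo (t / 2) t :=
    (Ioc_union_Ioo_eq_Ioo (by linarith) (by linarith)).symm
  have hI : 0 ≤ ∫ s in (0:ℝ)..t, (1 + s) ^ (-γ) := by
    refine intervalIntegral.integral_nonneg (by linarith) fun s hs => ?_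
    have := hs.1
    positivity
  rw [hsub, ENNReal.ofReal_add (by positivity) (by positivity)]
  refine (lintegral_union_le _ _ _).trans (add_le_add ?_ ?_)
  · calc _ ≤ ∫⁻ s in Ioc 0 (t / 2), ENNReal.ofReal (K1 * (t / 2) ^ (-1 - α)) *
          ENNReal.ofReal ((1 + s) ^ (-γ)) := by
          refine setLIntegral_mono' measurableSet_Ioc fun s hs => ?_
          rw [mul_comm]
          gcongr
          refine (h1 _ (by linarith [hs.2])).trans (ENNReal.ofReal_le_ofReal ?_)
          refine mul_le_mul_of_nonneg_left ?_ hK1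
          exact rpow_le_rpow_of_nonpos (by linarith) (by linarith [hs.2]) (by linarith)
      _ ≤ ENNReal.ofReal (K1 * (t / 2) ^ (-1 - α)) *
          ∫⁻ s in Ioc 0 t, ENNReal.ofReal ((1 + s) ^ (-γ)) := by
          rw [lintegral_const_mul' _ _ ENNReal.ofReal_ne_top]
          gcongr
          linarith
      _ = _ := by
          rw [ENNReal.ofReal_mul (p := K1 * (t / 2) ^ (-1 - α)) (by positivity)]
          congr 1
          rw [intervalIntegral.integral_of_le (by linarith), ofReal_integral_eq_lintegral_ofReal]
          · exact (intervalIntegrable_iff_integrableOn_Ioc_of_le (by linarith)).1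
              (weight_intble γ t (by linarith))
          · filter_upwards [ae_restrict_mem measurableSet_Ioc] with s hs
            have := hs.1
            positivity
  · calc _ ≤ ∫⁻ s in Ioo (t / 2) t, ENNReal.ofReal (2 ^ |γ| * t ^ (-γ)) * Φ (t - s) := by
          refine setLIntegral_mono' measurableSet_Ioo fun s hs => ?_
          gcongr
          exact weight_le ht hs.1 hs.2
      _ ≤ ENNReal.ofReal (2 ^ |γ| * t ^ (-γ)) * ∫⁻ s, (Ioi 0).indicator Φ (t - s) := by
          rw [lintegral_const_mul' _ _ ENNReal.ofReal_ne_top]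
          refine mul_le_mul' le_rfl ?_
          rw [← lintegral_indicator measurableSet_Ioo]
          refine lintegral_mono fun s => ?_
          by_cases hs : s ∈ Ioo (t / 2) t
          · have h3 : t - s ∈ Ioi (0:ℝ) := by simpa using hs.2
            rw [indicator_of_mem hs, indicator_of_mem h3]
          · rw [indicator_of_notMem hs]; exact zero_le
      _ ≤ _ := by
          rw [lintegral_sub_left_eq_self, lintegral_indicator measurableSet_Ioi,
            ENNReal.ofReal_mul (p := 2 ^ |γ| * t ^ (-γ)) (by positivity)]
          exact mul_le_mul' le_rfl h2

lemma inner_bound (N : ℕ) (α β : ℝ) (hNpos : 0 < N) (hβ : 0 < β) (hN : 4 * β < (N : ℝ))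
    (c₂ : ℝ) (hc₂ : 0 < c₂)
    (Y : EuclideanSpace ℝ (Fin N) → ℝ → ℝ) (hY0 : ∀ z τ, 0 < τ → 0 ≤ Y z τ)
    (hYle : ∀ z τ, z ≠ 0 → 0 < τ → Y z τ ≤ c₂ * wk N α β ‖z‖ τ)
    (f : EuclideanSpace ℝ (Fin N) → ℝ → ℝ)
    (hfmeas : Measurable (Function.uncurry f))
    (γ : ℝ) (C₀ : ℝ) (hC₀ : 0 < C₀)
    (hf1 : ∀ t : ℝ, 0 ≤ t →
      eLpNorm (fun y => f y t) 1 volume ≤ ENNReal.ofReal (C₀ * (1 + t) ^ (-γ)))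
    (R₀ C₁ : ℝ) (hC₁ : 0 < C₁)
    (hfdec : ∀ (x : EuclideanSpace ℝ (Fin N)) (t : ℝ), R₀ ≤ ‖x‖ → 0 ≤ t →
      |f x t| ≤ C₁ * ‖x‖ ^ (-(N : ℝ)) * (1 + t) ^ (-γ))
    (ρ B : ℝ) (hρ : 0 < ρ) (hρR : R₀ ≤ ρ) (hρB : ρ ≤ B)
    (x : EuclideanSpace ℝ (Fin N)) (hx : 2 * ρ ≤ ‖x‖) (s τ : ℝ) (hs : 0 ≤ s) (hτ : 0 < τ) :
    ∫⁻ y, ‖Y (x - y) τ * f y s‖ₑ ≤ ENNReal.ofReal ((1 + s) ^ (-γ)) *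
      (ENNReal.ofReal (c₂ * C₀ * wk N α β ρ τ) +
        ENNReal.ofReal (c₂ * C₁ * ρ ^ (-(N : ℝ))) * Hk N α β B τ) := by
  have : Nontrivial (EuclideanSpace ℝ (Fin N)) := by
    apply Module.nontrivial_of_finrank_pos (R := ℝ); simpa using hNpos
  have hw : 0 ≤ wk N α β ρ τ := wk_nonneg _ _ _ _ _ hρ.le hτ.le
  have hfs : Measurable (fun y => f y s) := hfmeas.comp (measurable_id.prodMk measurable_const)
  set F : EuclideanSpace ℝ (Fin N) → ℝ≥0∞ :=
    (Metric.ball 0 B).indicator (fun z => ENNReal.ofReal (wk N α β ‖z‖ τ)) with hF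
  have hpt : ∀ᵐ y : EuclideanSpace ℝ (Fin N) ∂volume, ‖Y (x - y) τ * f y s‖ₑ ≤
      ENNReal.ofReal (c₂ * wk N α β ρ τ) * ‖f y s‖ₑ +
      ENNReal.ofReal (c₂ * C₁ * ρ ^ (-(N : ℝ)) * (1 + s) ^ (-γ)) * F (x - y) := by
    have h0 : ∀ᵐ y : EuclideanSpace ℝ (Fin N) ∂volume, y ≠ x := by simp [ae_iff]
    filter_upwards [h0] with y hy
    have hz : x - y ≠ 0 := sub_ne_zero.2 hy.symm
    rw [enorm_mul, Real.enorm_of_nonneg (hY0 _ _ hτ)]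
    rcases le_or_gt ρ ‖x - y‖ with h | h
    · refine le_add_right ?_
      gcongr
      refine (hYle _ _ hz hτ).trans ?_
      exact mul_le_mul_of_nonneg_left (wk_anti hN hβ hρ h hτ.le) hc₂.le
    · refine le_add_left ?_
      have hmem : x - y ∈ Metric.ball (0 : EuclideanSpace ℝ (Fin N)) B := by
        rw [mem_ball_zero_iff]; linarith
      have hyρ : ρ ≤ ‖y‖ := by
        have := norm_sub_norm_le x y
        linarith
      have hfy : |f y s| ≤ C₁ * ρ ^ (-(N : ℝ)) * (1 + s) ^ (-γ) := by
        refine (hfdec y s (hρR.trans hyρ) hs).trans ?_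
        have : ‖y‖ ^ (-(N : ℝ)) ≤ ρ ^ (-(N : ℝ)) :=
          rpow_le_rpow_of_nonpos hρ hyρ (by simp)
        gcongr
      rw [hF, indicator_of_mem hmem, ← ENNReal.ofReal_mul (by positivity),
        ← ofReal_norm, Real.norm_eq_abs, ← ENNReal.ofReal_mul (hY0 _ _ hτ)]
      apply ENNReal.ofReal_le_ofReal
      calc _ ≤ (c₂ * wk N α β ‖x - y‖ τ) * (C₁ * ρ ^ (-(N : ℝ)) * (1 + s) ^ (-γ)) :=
            mul_le_mul (hYle _ _ hz hτ) hfy (abs_nonneg _)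
              (mul_nonneg hc₂.le (wk_nonneg _ _ _ _ _ (norm_nonneg _) hτ.le))
        _ = _ := by ring
  refine (lintegral_mono_ae hpt).trans ?_
  rw [lintegral_add_left (by fun_prop), lintegral_const_mul' _ _ ENNReal.ofReal_ne_top,
    lintegral_const_mul' _ _ ENNReal.ofReal_ne_top, lintegral_sub_left_eq_self, hF,
    lintegral_indicator Metric.isOpen_ball.measurableSet, mul_add]
  refine add_le_add ?_ ?_
  · have := hf1 s hs
    rw [eLpNorm_one_eq_lintegral_enorm] at this
    refine (mul_le_mul' le_rfl this).trans ?_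
    rw [← ENNReal.ofReal_mul (by positivity), ← ENNReal.ofReal_mul (by positivity)]
    apply ENNReal.ofReal_le_ofReal
    apply le_of_eq; ring
  · rw [← mul_assoc, ← ENNReal.ofReal_mul (by positivity)]
    unfold Hk
    rw [mul_comm ((1 + s) ^ (-γ))]

lemma pointwise_bound (N : ℕ) (α β : ℝ)
    (hα : 0 < α) (hβ : 0 < β) (hN : 4 * β < (N : ℝ))
    (c₂ : ℝ) (hc₂ : 0 < c₂)
    (Y : EuclideanSpace ℝ (Fin N) → ℝ → ℝ) (hY0 : ∀ z τ, 0 < τ → 0 ≤ Y z τ)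
    (hYle : ∀ z τ, z ≠ 0 → 0 < τ → Y z τ ≤ c₂ * wk N α β ‖z‖ τ)
    (f : EuclideanSpace ℝ (Fin N) → ℝ → ℝ)
    (hfmeas : Measurable (Function.uncurry f))
    (γ : ℝ) (C₀ : ℝ) (hC₀ : 0 < C₀)
    (hf1 : ∀ t : ℝ, 0 ≤ t →
      eLpNorm (fun y => f y t) 1 volume ≤ ENNReal.ofReal (C₀ * (1 + t) ^ (-γ)))
    (R₀ C₁ : ℝ) (hC₁ : 0 < C₁)
    (hfdec : ∀ (x : EuclideanSpace ℝ (Fin N)) (t : ℝ), R₀ ≤ ‖x‖ → 0 ≤ t →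
      |f x t| ≤ C₁ * ‖x‖ ^ (-(N : ℝ)) * (1 + t) ^ (-γ))
    (u : EuclideanSpace ℝ (Fin N) → ℝ → ℝ)
    (hu : ∀ x t, u x t = ∫ s in Set.Ioc (0:ℝ) t, ∫ y, Y (x - y) (t - s) * f y s)
    (ν μ : ℝ) (hν : 0 < ν) (hνμ : ν < μ) :
    ∃ K : ℝ, 0 < K ∧ ∀ t gt : ℝ, 1 ≤ t → 0 < gt → R₀ ≤ ν / 2 * gt →
      ∀ x : EuclideanSpace ℝ (Fin N), ν * gt ≤ ‖x‖ →
        ‖u x t‖ ≤ K * (gt ^ (2 * β - (N : ℝ)) * (t ^ (-γ) +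
          t ^ (-(1 + α)) * gt ^ (2 * β) * ∫ s in (0:ℝ)..t, (1 + s) ^ (-γ))) := by
  have hNpos : 0 < N := by
    have : (0:ℝ) < N := by linarith
    exact_mod_cast this
  obtain ⟨KH, hKH, hH⟩ := Hk_bounds N α β hNpos hα hβ
  have hμ : 0 < μ := hν.trans hνμ
  set A1 := c₂ * C₀ * (ν / 2) ^ (4 * β - (N : ℝ)) +
    c₂ * C₁ * (ν / 2) ^ (-(N : ℝ)) * (KH * μ ^ (4 * β)) with hA1
  set A2 := c₂ * C₀ * ((1 / (2 * α) + 1 / α) * (ν / 2) ^ (2 * β - (N : ℝ))) +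
    c₂ * C₁ * (ν / 2) ^ (-(N : ℝ)) * (KH * μ ^ (2 * β)) with hA2
  have hA1p : 0 < A1 := by positivity
  have hA2p : 0 < A2 := by positivity
  refine ⟨A1 * 2 ^ (1 + α) + 2 ^ |γ| * A2, by positivity, ?_⟩
  intro t gt ht hgt hgR x hx
  set ρ := ν / 2 * gt with hρdef
  set B := μ * gt with hBdef
  have hρ : 0 < ρ := by positivity
  have hB : 0 < B := by positivity
  have hρB : ρ ≤ B := by
    rw [hρdef, hBdef]; gcongr; linarith
  obtain ⟨hHp, hHi⟩ := hH B hB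
  set Φ : ℝ → ℝ≥0∞ := fun τ => ENNReal.ofReal (c₂ * C₀ * wk N α β ρ τ) +
        ENNReal.ofReal (c₂ * C₁ * ρ ^ (-(N : ℝ))) * Hk N α β B τ with hΦ
  have e1 : A1 * gt ^ (4 * β - (N : ℝ)) = c₂ * C₀ * ρ ^ (4 * β - (N : ℝ)) +
      c₂ * C₁ * ρ ^ (-(N : ℝ)) * (KH * B ^ (4 * β)) := by
    rw [hA1, hρdef, hBdef, mul_rpow (by positivity) hgt.le, mul_rpow (by positivity) hgt.le,
      mul_rpow (by positivity) hgt.le, show 4 * β - (N : ℝ) = -(N : ℝ) + 4 * β by ring,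
      rpow_add hgt]
    ring
  have e2 : A2 * gt ^ (2 * β - (N : ℝ)) = c₂ * C₀ * ((1 / (2 * α) + 1 / α) * ρ ^ (2 * β - (N : ℝ))) +
      c₂ * C₁ * ρ ^ (-(N : ℝ)) * (KH * B ^ (2 * β)) := by
    rw [hA2, hρdef, hBdef, mul_rpow (by positivity) hgt.le, mul_rpow (by positivity) hgt.le,
      mul_rpow (by positivity) hgt.le, show 2 * β - (N : ℝ) = -(N : ℝ) + 2 * β by ring,
      rpow_add hgt]
    ring
  have hΦ1 : ∀ τ, 0 < τ → Φ τ ≤ ENNReal.ofReal ((A1 * gt ^ (4 * β - (N : ℝ))) * τ ^ (-1 - α)) := by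
    intro τ hτ
    rw [e1, add_mul, ENNReal.ofReal_add (by positivity) (by positivity)]
    refine add_le_add (ENNReal.ofReal_le_ofReal ?_) ?_
    · rw [mul_assoc (c₂ * C₀) (ρ ^ (4 * β - (N : ℝ))), mul_comm (ρ ^ (4 * β - (N : ℝ)))]
      exact mul_le_mul_of_nonneg_left (min_le_left _ _) (by positivity)
    · rw [mul_assoc (c₂ * C₁ * ρ ^ (-(N : ℝ))), ENNReal.ofReal_mul (p := c₂ * C₁ * ρ ^ (-(N : ℝ))) (by positivity)]
      exact mul_le_mul' le_rfl (hHp τ hτ)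
  have hΦ2 : ∫⁻ τ in Ioi 0, Φ τ ≤ ENNReal.ofReal (A2 * gt ^ (2 * β - (N : ℝ))) := by
    rw [e2, ENNReal.ofReal_add (by positivity) (by positivity), hΦ]
    rw [lintegral_add_left (by unfold wk; fun_prop), lintegral_const_mul' _ _ ENNReal.ofReal_ne_top]
    refine add_le_add ?_ ?_
    · have hcc : 0 ≤ c₂ * C₀ := by positivity
      simp only [ENNReal.ofReal_mul hcc]
      rw [lintegral_const_mul' _ _ ENNReal.ofReal_ne_top]
      exact mul_le_mul' le_rfl (wk_time hα hρ)
    · rw [ENNReal.ofReal_mul (p := c₂ * C₁ * ρ ^ (-(N : ℝ))) (by positivity)]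
      exact mul_le_mul' le_rfl hHi
  have hmain := time_lemma (γ := γ) hα ht (by positivity) (by positivity) Φ hΦ1 hΦ2
  have hI : 0 ≤ ∫ s in (0:ℝ)..t, (1 + s) ^ (-γ) := by
    refine intervalIntegral.integral_nonneg (by linarith) fun s hs => ?_
    have := hs.1
    positivity
  set I := ∫ s in (0:ℝ)..t, (1 + s) ^ (-γ) with hIdef
  have hu1 : ‖u x t‖ₑ ≤ ∫⁻ s in Ioo 0 t, ENNReal.ofReal ((1 + s) ^ (-γ)) * Φ (t - s) := by
    rw [hu]
    refine (enorm_integral_le_lintegral_enorm _).trans ?_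
    rw [← restrict_Ioo_eq_restrict_Ioc]
    refine setLIntegral_mono' measurableSet_Ioo fun s hs => ?_
    refine (enorm_integral_le_lintegral_enorm _).trans ?_
    exact inner_bound N α β hNpos hβ hN c₂ hc₂ Y hY0 hYle f hfmeas γ C₀ hC₀ hf1 R₀ C₁ hC₁ hfdec
      ρ B hρ hgR hρB x (by rw [hρdef]; linarith) s (t - s) hs.1.le (by linarith [hs.2])
  have hu2 := hu1.trans hmain
  rw [← ofReal_norm] at hu2
  have ht0 : 0 < t := by linarith
  have hu3 := (ENNReal.ofReal_le_ofReal_iff (by positivity)).1 hu2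
  refine hu3.trans ?_
  have e3 : (t / 2) ^ (-1 - α) = 2 ^ (1 + α) * t ^ (-(1 + α)) := by
    rw [div_rpow ht0.le (by norm_num), show -1 - α = -(1 + α) by ring,
      rpow_neg (by norm_num : (0:ℝ) ≤ 2)]
    field_simp
  have e4 : gt ^ (4 * β - (N : ℝ)) = gt ^ (2 * β - (N : ℝ)) * gt ^ (2 * β) := by
    rw [← rpow_add hgt]; congr 1; ring
  rw [e3, e4]
  set X := gt ^ (2 * β - (N : ℝ))
  set Z := t ^ (-(1 + α)) * gt ^ (2 * β) * I with hZ
  have hX : 0 ≤ X := by positivity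
  have hZ0 : 0 ≤ Z := by positivity
  have hW : 0 ≤ t ^ (-γ) := by positivity
  have p1 : 0 ≤ A1 * 2 ^ (1 + α) := by positivity
  have p2 : 0 ≤ 2 ^ |γ| * A2 := by positivity
  calc _ = A1 * 2 ^ (1 + α) * (X * Z) + 2 ^ |γ| * A2 * (X * t ^ (-γ)) := by rw [hZ]; ring
    _ ≤ A1 * 2 ^ (1 + α) * (X * (t ^ (-γ) + Z)) + 2 ^ |γ| * A2 * (X * (t ^ (-γ) + Z)) := by
        gcongr <;> linarith
    _ = _ := by ring

lemma annulus_norm (N : ℕ) (p : ℝ≥0∞) (μ : ℝ) (hμ : 0 < μ) :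
    ∃ V : ℝ, 0 < V ∧ ∀ (ν gt M : ℝ) (v : EuclideanSpace ℝ (Fin N) → ℝ), 0 < gt → 0 ≤ M →
      (∀ x, ν * gt ≤ ‖x‖ → ‖v x‖ ≤ M) →
      eLpNorm v p (volume.restrict {x | ν ≤ ‖x‖ / gt ∧ ‖x‖ / gt ≤ μ}) ≤
        ENNReal.ofReal (V * gt ^ ((N : ℝ) * (1 / p.toReal)) * M) := by
  set ω := (volume : Measure (EuclideanSpace ℝ (Fin N))).real (Metric.ball 0 1) with hω
  have hωp : 0 < ω := by
    rw [hω]; exact ENNReal.toReal_pos (Metric.measure_ball_pos _ _ one_pos).ne' measure_ball_lt_top.ne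
  refine ⟨(μ ^ N * ω) ^ (1 / p.toReal), by positivity, ?_⟩
  intro ν gt M v hgt hM hv
  have hms : MeasurableSet {x : EuclideanSpace ℝ (Fin N) | ν ≤ ‖x‖ / gt ∧ ‖x‖ / gt ≤ μ} := by
    apply MeasurableSet.inter
    · exact measurableSet_le measurable_const (measurable_norm.div_const gt)
    · exact measurableSet_le (measurable_norm.div_const gt) measurable_const
  refine (eLpNorm_le_of_ae_bound (C := M) ?_).trans ?_
  · filter_upwards [ae_restrict_mem hms] with x hx
    exact hv x ((le_div_iff₀ hgt).1 hx.1)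
  · rw [Measure.restrict_apply_univ, ENNReal.ofReal_mul (by positivity)]
    refine mul_le_mul' ?_ le_rfl
    have hvol : volume {x : EuclideanSpace ℝ (Fin N) | ν ≤ ‖x‖ / gt ∧ ‖x‖ / gt ≤ μ} ≤
        ENNReal.ofReal ((μ * gt) ^ N * ω) := by
      calc _ ≤ volume (Metric.closedBall (0 : EuclideanSpace ℝ (Fin N)) (μ * gt)) := by
            apply measure_mono
            intro x hx
            rw [mem_closedBall_zero_iff]
            exact (div_le_iff₀ hgt).1 hx.2
        _ = _ := by
            rw [Measure.addHaar_closedBall _ _ (by positivity), finrank_euclideanSpace,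
              Fintype.card_fin, ENNReal.ofReal_mul (by positivity), hω,
              ofReal_measureReal measure_ball_lt_top.ne]
    calc _ ≤ (ENNReal.ofReal ((μ * gt) ^ N * ω)) ^ (p.toReal⁻¹) := by gcongr
      _ = _ := by
        rw [ENNReal.ofReal_rpow_of_nonneg (by positivity) (by positivity)]
        congr 1
        rw [one_div, mul_pow, mul_right_comm, mul_rpow (by positivity) (by positivity),
          ← rpow_natCast gt N, ← rpow_mul hgt.le]

lemma weight_integral (γ t : ℝ) (ht : 0 ≤ t) (hγ : γ ≠ 1) :
    ∫ s in (0:ℝ)..t, (1 + s) ^ (-γ) = ((1 + t) ^ (1 - γ) - 1) / (1 - γ) := by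
  rw [intervalIntegral.integral_comp_add_left (fun s : ℝ => s ^ (-γ)) 1, integral_rpow]
  · rw [add_zero, one_rpow, show -γ + 1 = 1 - γ by ring]
  · right
    refine ⟨fun h => hγ (by linarith), ?_⟩
    rw [uIcc_of_le (by linarith)]
    intro h
    linarith [h.1]

lemma weight_integral_one (t : ℝ) (ht : 2 ≤ t) :
    ∫ s in (0:ℝ)..t, (1 + s) ^ (-1 : ℝ) ≤ 2 * Real.log t := by
  rw [intervalIntegral.integral_comp_add_left (fun s : ℝ => s ^ (-1 : ℝ)) 1]
  simp only [rpow_neg_one]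
  rw [integral_inv_of_pos (by linarith) (by linarith), add_zero, div_one]
  calc Real.log (1 + t) ≤ Real.log (t ^ 2) := Real.log_le_log (by linarith) (by nlinarith)
    _ = _ := by rw [Real.log_pow]; norm_num

/-- Passage from the pointwise bound to the `L^p` bound on the annulus. -/
lemma final_step {n β q g K V M0 D E : ℝ} (hg : 0 < g) (hK : 0 < K) (hV : 0 < V)
    (hM : M0 ≤ D * E) :
    V * g ^ (n * (1 / q)) * (K * (g ^ (2 * β - n) * M0)) ≤
      V * K * D * g ^ (2 * β - n * (1 - 1 / q)) * E := by
  have : g ^ (2 * β - n * (1 - 1 / q)) = g ^ (n * (1 / q)) * g ^ (2 * β - n) := by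
    rw [← rpow_add hg]; congr 1; ring
  rw [this]
  calc _ = V * g ^ (n * (1 / q)) * K * g ^ (2 * β - n) * M0 := by ring
    _ ≤ V * g ^ (n * (1 / q)) * K * g ^ (2 * β - n) * (D * E) := by gcongr
    _ = _ := by ring

theorem intermediate_decay_supercritical
    (N : ℕ) (α β : ℝ)
    (hα : 0 < α ∧ α < 1) (hβ : 0 < β ∧ β ≤ 1) (hN : 4 * β < (N : ℝ))
    (G : EuclideanSpace ℝ (Fin N) → ℝ)
    (hGmeas : Measurable G) (hGnonneg : ∀ ξ, 0 ≤ G ξ)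
    (c₁ c₂ : ℝ) (hc₁ : 0 < c₁) (hc₂ : 0 < c₂)
    (hGin : ∀ ξ : EuclideanSpace ℝ (Fin N), 0 < ‖ξ‖ → ‖ξ‖ ≤ 1 →
      c₁ * ‖ξ‖ ^ (4 * β - (N : ℝ)) ≤ G ξ ∧ G ξ ≤ c₂ * ‖ξ‖ ^ (4 * β - (N : ℝ)))
    (hGout : ∀ ξ : EuclideanSpace ℝ (Fin N), 1 ≤ ‖ξ‖ →
      c₁ * ‖ξ‖ ^ (-((N : ℝ) + 2 * β)) ≤ G ξ ∧ G ξ ≤ c₂ * ‖ξ‖ ^ (-((N : ℝ) + 2 * β)))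
    (Y : EuclideanSpace ℝ (Fin N) → ℝ → ℝ)
    (hY : ∀ x t, Y x t = t ^ (α - 1 - α * (N : ℝ) / (2 * β)) * G ((t ^ (-(α / (2 * β)))) • x))
    (f : EuclideanSpace ℝ (Fin N) → ℝ → ℝ)
    (hfmeas : Measurable (Function.uncurry f))
    (γ : ℝ) (C₀ : ℝ) (hC₀ : 0 < C₀)
    (hf1 : ∀ t : ℝ, 0 ≤ t →
      eLpNorm (fun y => f y t) 1 volume ≤ ENNReal.ofReal (C₀ * (1 + t) ^ (-γ)))
    (R₀ C₁ : ℝ) (hR₀ : 0 < R₀) (hC₁ : 0 < C₁)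
    (hfdec : ∀ (x : EuclideanSpace ℝ (Fin N)) (t : ℝ), R₀ ≤ ‖x‖ → 0 ≤ t →
      |f x t| ≤ C₁ * ‖x‖ ^ (-(N : ℝ)) * (1 + t) ^ (-γ))
    (u : EuclideanSpace ℝ (Fin N) → ℝ → ℝ)
    (hu : ∀ x t, u x t = ∫ s in Set.Ioc (0:ℝ) t, ∫ y, Y (x - y) (t - s) * f y s)
    (p : ℝ≥0∞) (hp : ENNReal.ofReal ((N : ℝ) / ((N : ℝ) - 2 * β)) ≤ p)
    (ν μ : ℝ) (hν : 0 < ν) (hνμ : ν < μ)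
    (g : ℝ → ℝ) (hgpos : ∀ t : ℝ, 0 < t → 0 < g t)
    (hginf : Tendsto g atTop atTop)
    (hgo : Tendsto (fun t => g t / t ^ (α / (2 * β))) atTop (nhds 0)) :
    ∃ C : ℝ, 0 < C ∧ ∃ t₀ : ℝ, 2 ≤ t₀ ∧ ∀ t : ℝ, t₀ ≤ t →
      (γ < 1 →
        eLpNorm (fun x => u x t) p (volume.restrict {x : EuclideanSpace ℝ (Fin N) | ν ≤ ‖x‖ / g t ∧ ‖x‖ / g t ≤ μ}) ≤
          ENNReal.ofReal (C * g t ^ (2 * β - (N : ℝ) * (1 - 1 / p.toReal)) * t ^ (-γ))) ∧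
      (γ = 1 →
        eLpNorm (fun x => u x t) p (volume.restrict {x : EuclideanSpace ℝ (Fin N) | ν ≤ ‖x‖ / g t ∧ ‖x‖ / g t ≤ μ}) ≤
          ENNReal.ofReal (C * g t ^ (2 * β - (N : ℝ) * (1 - 1 / p.toReal)) *
            max (t ^ (-1 : ℝ)) (t ^ (-(1 + α)) * g t ^ (2 * β) * Real.log t))) ∧
      (1 < γ →
        eLpNorm (fun x => u x t) p (volume.restrict {x : EuclideanSpace ℝ (Fin N) | ν ≤ ‖x‖ / g t ∧ ‖x‖ / g t ≤ μ}) ≤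
          ENNReal.ofReal (C * g t ^ (2 * β - (N : ℝ) * (1 - 1 / p.toReal)) *
            max (t ^ (-γ)) (t ^ (-(1 + α)) * g t ^ (2 * β)))) := by
  obtain ⟨hα0, hα1⟩ := hα
  obtain ⟨hβ0, hβ1⟩ := hβ
  have hμ : 0 < μ := hν.trans hνμ
  obtain ⟨K, hK, hpt⟩ := pointwise_bound N α β hα0 hβ0 hN c₂ hc₂ Y
    (fun z τ hτ => by rw [hY]; exact mul_nonneg (rpow_nonneg hτ.le _) (hGnonneg _))
    (fun z τ hz hτ => by
      rw [hY]
      exact Y_bound N α β hβ0 G c₂ hc₂ (fun ξ h h' => (hGin ξ h h').2) (fun ξ h => (hGout ξ h).2)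
        z hz τ hτ)
    f hfmeas γ C₀ hC₀ hf1 R₀ C₁ hC₁ hfdec u hu ν μ hν hνμ
  obtain ⟨V, hV, hann⟩ := annulus_norm N p μ hμ
  have hev : ∀ᶠ t in atTop, R₀ / (ν / 2) ≤ g t ∧ g t / t ^ (α / (2 * β)) ≤ 1 :=
    (hginf.eventually_ge_atTop _).and (hgo.eventually_le_const one_pos)
  obtain ⟨t₁, ht₁⟩ := eventually_atTop.1 hev
  set D : ℝ := 3 + 2 ^ (1 - γ) / |1 - γ| + 1 / |1 - γ| with hD
  have q1 : 0 ≤ (2:ℝ) ^ (1 - γ) / |1 - γ| := by positivity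
  have q2 : 0 ≤ 1 / |1 - γ| := by positivity
  have hDp : 0 < D := by positivity
  refine ⟨V * K * D, by positivity, max 2 t₁, le_max_left _ _, fun t ht => ?_⟩
  have ht2 : 2 ≤ t := (le_max_left _ _).trans ht
  have ht0 : 0 < t := by linarith
  obtain ⟨hg1, hg2⟩ := ht₁ t ((le_max_right _ _).trans ht)
  have hg : 0 < g t := hgpos t ht0
  have hgR : R₀ ≤ ν / 2 * g t := by
    rw [div_le_iff₀ (by positivity)] at hg1; linarith
  have hgα : g t ^ (2 * β) ≤ t ^ α := by
    rw [div_le_one (by positivity)] at hg2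
    calc g t ^ (2 * β) ≤ (t ^ (α / (2 * β))) ^ (2 * β) := by gcongr
      _ = t ^ α := by rw [← rpow_mul ht0.le]; congr 1; field_simp
  have hI : 0 ≤ ∫ s in (0:ℝ)..t, (1 + s) ^ (-γ) := by
    refine intervalIntegral.integral_nonneg (by linarith) fun s hs => ?_
    have := hs.1
    positivity
  have hnorm := hann ν (g t) _ (fun x => u x t) hg (by positivity)
    (fun x hx => hpt t (g t) (by linarith) hg hgR x hx)
  have concl : ∀ E : ℝ, t ^ (-γ) + t ^ (-(1 + α)) * g t ^ (2 * β) *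
      (∫ s in (0:ℝ)..t, (1 + s) ^ (-γ)) ≤ D * E →
      eLpNorm (fun x => u x t) p (volume.restrict {x : EuclideanSpace ℝ (Fin N) | ν ≤ ‖x‖ / g t ∧ ‖x‖ / g t ≤ μ}) ≤
        ENNReal.ofReal (V * K * D * g t ^ (2 * β - (N : ℝ) * (1 - 1 / p.toReal)) * E) :=
    fun E hE => hnorm.trans (ENNReal.ofReal_le_ofReal (final_step hg hK hV hE))
  have hZ : 0 ≤ t ^ (-(1 + α)) * g t ^ (2 * β) := by positivity
  have hW : 0 ≤ t ^ (-γ) := by positivity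
  refine ⟨fun hγ => concl _ ?_, fun hγ => concl _ ?_, fun hγ => concl _ ?_⟩
  · have habs : |1 - γ| = 1 - γ := abs_of_pos (by linarith)
    have hpos : 0 < 1 - γ := by linarith
    have hIle : ∫ s in (0:ℝ)..t, (1 + s) ^ (-γ) ≤ 2 ^ (1 - γ) / |1 - γ| * t ^ (1 - γ) := by
      rw [weight_integral γ t ht0.le hγ.ne, habs, div_mul_eq_mul_div, ← mul_rpow (by norm_num) ht0.le]
      gcongr
      have : (1 + t) ^ (1 - γ) ≤ (2 * t) ^ (1 - γ) := by
        gcongr; linarith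
      linarith
    have hZ' : t ^ (-(1 + α)) * g t ^ (2 * β) * t ^ (1 - γ) ≤ t ^ (-γ) := by
      calc _ ≤ t ^ (-(1 + α)) * t ^ α * t ^ (1 - γ) := by gcongr
        _ = _ := by rw [← rpow_add ht0, ← rpow_add ht0]; congr 1; ring
    calc _ ≤ t ^ (-γ) + t ^ (-(1 + α)) * g t ^ (2 * β) * (2 ^ (1 - γ) / |1 - γ| * t ^ (1 - γ)) := by
          gcongr
      _ = t ^ (-γ) + 2 ^ (1 - γ) / |1 - γ| * (t ^ (-(1 + α)) * g t ^ (2 * β) * t ^ (1 - γ)) := by ring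
      _ ≤ t ^ (-γ) + 2 ^ (1 - γ) / |1 - γ| * t ^ (-γ) := by gcongr
      _ = (1 + 2 ^ (1 - γ) / |1 - γ|) * t ^ (-γ) := by ring
      _ ≤ _ := by gcongr; linarith
  · have hD3 : 3 ≤ D := by linarith
    rw [hγ]
    have h1 := weight_integral_one t ht2
    set E := max (t ^ (-1 : ℝ)) (t ^ (-(1 + α)) * g t ^ (2 * β) * Real.log t)
    have hE1 : t ^ (-1 : ℝ) ≤ E := le_max_left _ _
    have hE2 : t ^ (-(1 + α)) * g t ^ (2 * β) * Real.log t ≤ E := le_max_right _ _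
    have hE0 : 0 ≤ E := le_trans (by positivity) hE1
    calc _ ≤ t ^ (-1 : ℝ) + t ^ (-(1 + α)) * g t ^ (2 * β) * (2 * Real.log t) := by gcongr
      _ ≤ 3 * E := by linarith
      _ ≤ _ := by gcongr
  · have habs : |1 - γ| = γ - 1 := by rw [abs_of_neg (by linarith)]; ring
    have hpos : 0 < γ - 1 := by linarith
    have hIle : ∫ s in (0:ℝ)..t, (1 + s) ^ (-γ) ≤ 1 / |1 - γ| := by
      rw [weight_integral γ t ht0.le hγ.ne', habs, ← neg_div_neg_eq, neg_sub, neg_sub]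
      gcongr
      have : 0 ≤ (1 + t) ^ (1 - γ) := by positivity
      linarith
    set E := max (t ^ (-γ)) (t ^ (-(1 + α)) * g t ^ (2 * β))
    have hE1 : t ^ (-γ) ≤ E := le_max_left _ _
    have hE2 : t ^ (-(1 + α)) * g t ^ (2 * β) ≤ E := le_max_right _ _
    have hE0 : 0 ≤ E := hW.trans hE1
    calc _ ≤ E + E * (1 / |1 - γ|) := by gcongr
      _ = (1 + 1 / |1 - γ|) * E := by ring
      _ ≤ _ := by gcongr; linarith
end

section
/- Let p ∈ [1, p_c), γ ∈ ℝ, and suppose ‖f(·,t)‖_{L^1(ℝ^N)} ≤ C₀ (1+t)^{−γ} for all t ≥ 0. Then there is a constant C such that the mild solution u satisfies, for all t ≥ 2: ‖u(·,t)‖_{L^p(ℝ^N)} ≤ C t^{−γ+α−(αN/(2β))(1−1/p)} if γ < 1; ≤ C t^{−1+α−(αN/(2β))(1−1/p)} log t if γ = 1; and ≤ C t^{−1+α−(αN/(2β))(1−1/p)} if γ > 1. -/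
open MeasureTheory Real Set Filter
open scoped ENNReal Pointwise

lemma mink_aux {E Z : Type*} [MeasurableSpace E] [MeasurableSpace Z] (μ : Measure E) (ν : Measure Z)
    [SFinite μ] [SFinite ν] (K : E → Z → ℝ≥0∞) (hK : Measurable (Function.uncurry K))
    (w : Z → ℝ≥0∞) (hw : Measurable w) (κ : Z → ℝ≥0∞) (hκ : Measurable κ)
    (hκ0 : ∀ᵐ z ∂ν, κ z ≠ 0 ∧ κ z ≠ ∞) (p : ℝ) (hp : 1 ≤ p) (M : ℝ≥0∞)
    (hM : ∀ᵐ z ∂ν, ∫⁻ x, K x z ^ p ∂μ ≤ M * κ z ^ p) :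
    ∫⁻ x, (∫⁻ z, K x z * w z ∂ν) ^ p ∂μ ≤ M * (∫⁻ z, κ z * w z ∂ν) ^ p := by
  have hp0 : 0 < p := by linarith
  have hq : 0 ≤ 1 - 1 / p := by
    have : 1 / p ≤ 1 := by rw [div_le_one hp0]; exact hp
    linarith
  set A := ∫⁻ z, κ z * w z ∂ν with hA
  have h1 : ∀ x, (∫⁻ z, K x z * w z ∂ν) ^ p
      ≤ (∫⁻ z, K x z ^ p * κ z ^ (1 - p) * w z ∂ν) * A ^ (p - 1) := by
    intro x
    have hKx : Measurable (K x) := hK.comp (measurable_const.prodMk measurable_id)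
    have hold := ENNReal.lintegral_mul_norm_pow_le (μ := ν)
      (f := fun z => K x z ^ p * κ z ^ (1 - p) * w z) (g := fun z => κ z * w z)
      (by fun_prop) (by fun_prop) (p := 1 / p) (q := 1 - 1 / p) (by positivity) hq (by ring)
    have heq : ∫⁻ z, K x z * w z ∂ν = ∫⁻ z, (K x z ^ p * κ z ^ (1 - p) * w z) ^ (1 / p) *
        (κ z * w z) ^ (1 - 1 / p) ∂ν := by
      apply lintegral_congr_ae
      filter_upwards [hκ0] with z hz
      have i0 : 0 ≤ 1 / p := by positivity
      rw [ENNReal.mul_rpow_of_nonneg _ _ i0, ENNReal.mul_rpow_of_nonneg _ _ i0,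
        ENNReal.mul_rpow_of_nonneg _ _ hq, ← ENNReal.rpow_mul, ← ENNReal.rpow_mul]
      have e1 : p * (1 / p) = 1 := by field_simp
      have e2 : (1 - p) * (1 / p) = -(1 - 1 / p) := by field_simp; ring
      rw [e1, e2, ENNReal.rpow_one]
      have e3 : κ z ^ (-(1 - 1 / p)) * κ z ^ (1 - 1 / p) = 1 := by
        rw [← ENNReal.rpow_add _ _ hz.1 hz.2]; simp
      have e4 : w z ^ (1 / p) * w z ^ (1 - 1 / p) = w z := by
        rw [← ENNReal.rpow_add_of_nonneg _ _ i0 hq]; simp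
      calc K x z * w z = K x z * (κ z ^ (-(1 - 1 / p)) * κ z ^ (1 - 1 / p)) *
            (w z ^ (1 / p) * w z ^ (1 - 1 / p)) := by rw [e3, e4, mul_one]
        _ = _ := by ring
    rw [heq]
    calc _ ≤ ((∫⁻ z, K x z ^ p * κ z ^ (1 - p) * w z ∂ν) ^ (1 / p) * A ^ (1 - 1 / p)) ^ p := by
          gcongr
      _ = _ := by
        rw [ENNReal.mul_rpow_of_nonneg _ _ hp0.le, ← ENNReal.rpow_mul, ← ENNReal.rpow_mul]
        have e1 : 1 / p * p = 1 := by field_simp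
        have e2 : (1 - 1 / p) * p = p - 1 := by field_simp
        rw [e1, e2, ENNReal.rpow_one]
  have hK' : Measurable (fun q : E × Z => K q.1 q.2) := hK
  have hmeas : Measurable (Function.uncurry
      (fun (x : E) (z : Z) => K x z ^ p * κ z ^ (1 - p) * w z)) := by
    change Measurable (fun q : E × Z => K q.1 q.2 ^ p * κ q.2 ^ (1 - p) * w q.2)
    fun_prop
  calc ∫⁻ x, (∫⁻ z, K x z * w z ∂ν) ^ p ∂μ
      ≤ ∫⁻ x, (∫⁻ z, K x z ^ p * κ z ^ (1 - p) * w z ∂ν) * A ^ (p - 1) ∂μ := lintegral_mono h1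
    _ = (∫⁻ x, ∫⁻ z, K x z ^ p * κ z ^ (1 - p) * w z ∂ν ∂μ) * A ^ (p - 1) :=
        lintegral_mul_const _ hmeas.lintegral_prod_right
    _ = (∫⁻ z, ∫⁻ x, K x z ^ p * κ z ^ (1 - p) * w z ∂μ ∂ν) * A ^ (p - 1) := by
        rw [lintegral_lintegral_swap hmeas.aemeasurable]
    _ ≤ (∫⁻ z, M * (κ z * w z) ∂ν) * A ^ (p - 1) := by
        gcongr 1
        apply lintegral_mono_ae
        filter_upwards [hκ0, hM] with z hz hMz
        have hKz : Measurable (fun x => K x z) := hK.comp (measurable_id.prodMk measurable_const)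
        simp_rw [mul_assoc]
        rw [lintegral_mul_const _ (by fun_prop)]
        calc _ ≤ M * κ z ^ p * (κ z ^ (1 - p) * w z) := by gcongr
          _ = M * (κ z ^ p * κ z ^ (1 - p) * w z) := by ring
          _ = _ := by
            rw [← ENNReal.rpow_add _ _ hz.1 hz.2]; simp
    _ = M * A ^ p := by
        rw [lintegral_const_mul _ (by fun_prop), ← hA, mul_assoc]
        congr 1
        nth_rewrite 1 [← ENNReal.rpow_one A]
        rw [← ENNReal.rpow_add_of_nonneg _ _ zero_le_one (by linarith)]
        congr 1; ring

lemma scale_aux {N : ℕ} (g : EuclideanSpace ℝ (Fin N) → ℝ≥0∞) (hg : Measurable g)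
    (r : ℝ) (hr : 0 < r) (y : EuclideanSpace ℝ (Fin N)) :
    ∫⁻ x, g (r • (x - y)) = ENNReal.ofReal (r ^ (-(N : ℝ))) * ∫⁻ x, g x := by
  rw [lintegral_sub_right_eq_self (fun x => g (r • x)) y]
  have h := Measure.map_addHaar_smul (volume : Measure (EuclideanSpace ℝ (Fin N))) hr.ne'
  have h2 := lintegral_map (μ := volume) hg (measurable_const_smul (M := ℝ) (α := EuclideanSpace ℝ (Fin N)) r)
  rw [← h2, h, lintegral_smul_measure]
  simp only [smul_eq_mul, finrank_euclideanSpace, Fintype.card_fin]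
  rw [abs_of_pos (by positivity), rpow_neg hr.le, rpow_natCast]

lemma Gint_aux {N : ℕ} {β : ℝ} (hβ : 0 < β) (hN : 4 * β < (N : ℝ))
    (G : EuclideanSpace ℝ (Fin N) → ℝ)
    (c₂ : ℝ) (hc₂ : 0 < c₂)
    (hGin : ∀ ξ : EuclideanSpace ℝ (Fin N), 0 < ‖ξ‖ → ‖ξ‖ ≤ 1 → G ξ ≤ c₂ * ‖ξ‖ ^ (4 * β - (N : ℝ)))
    (hGout : ∀ ξ : EuclideanSpace ℝ (Fin N), 1 ≤ ‖ξ‖ → G ξ ≤ c₂ * ‖ξ‖ ^ (-((N : ℝ) + 2 * β)))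
    (p : ℝ) (hp1 : 1 ≤ p) (hpc : p < (N : ℝ) / ((N : ℝ) - 2 * β)) :
    ∫⁻ x, ENNReal.ofReal (G x) ^ p < ∞ := by
  have hN0 : (0 : ℝ) < N := by linarith
  have hN1 : 1 ≤ N := by exact_mod_cast hN0
  have : NeZero N := ⟨by omega⟩
  have : Nontrivial (EuclideanSpace ℝ (Fin N)) := by
    apply Module.nontrivial_of_finrank_pos (R := ℝ); simp; omega
  have hp0 : 0 < p := by linarith
  rw [lt_div_iff₀ (by linarith)] at hpc
  set h : ℝ → ℝ := fun r => if r ≤ 1 then c₂ ^ p * r ^ ((4 * β - N) * p) else c₂ ^ p * r ^ (-(N + 2 * β) * p) with hh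
  have hint : Integrable (fun x : EuclideanSpace ℝ (Fin N) => h ‖x‖) volume := by
    rw [integrable_fun_norm_addHaar]
    simp only [finrank_euclideanSpace, Fintype.card_fin, smul_eq_mul]
    have hsplit : Ioi (0:ℝ) = Ioc 0 1 ∪ Ioi 1 := by simp
    have key : ∀ y : ℝ, 0 < y → ∀ a : ℝ, y ^ (N - 1) * (c₂ ^ p * y ^ a) = c₂ ^ p * y ^ ((N : ℝ) - 1 + a) := by
      intro y hy a
      have e : (N : ℝ) - 1 = ((N - 1 : ℕ) : ℝ) := by rw [Nat.cast_sub hN1, Nat.cast_one]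
      rw [e, rpow_add hy, rpow_natCast]; ring
    rw [hsplit]
    apply IntegrableOn.union
    · have : IntegrableOn (fun y : ℝ => c₂ ^ p * y ^ ((N : ℝ) - 1 + (4 * β - N) * p)) (Ioc 0 1) := by
        apply Integrable.const_mul
        rw [← IntegrableOn, ← intervalIntegrable_iff_integrableOn_Ioc_of_le zero_le_one]
        apply intervalIntegral.intervalIntegrable_rpow'
        nlinarith
      refine this.congr_fun ?_ measurableSet_Ioc
      intro y hy
      simp only [hh, if_pos hy.2]
      rw [key y hy.1]
    · have : IntegrableOn (fun y : ℝ => c₂ ^ p * y ^ ((N : ℝ) - 1 + -(N + 2 * β) * p)) (Ioi 1) := by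
        apply Integrable.const_mul
        apply integrableOn_Ioi_rpow_of_lt _ zero_lt_one
        nlinarith
      refine this.congr_fun ?_ measurableSet_Ioi
      intro y hy
      have hy : 1 < y := hy
      simp only [hh, if_neg (not_le.2 hy)]
      rw [key y (by linarith)]
  refine lt_of_le_of_lt (lintegral_mono_ae ?_) hint.lintegral_lt_top
  have hne : ∀ᵐ x : EuclideanSpace ℝ (Fin N), x ≠ 0 := by
    rw [ae_iff]; simp
  filter_upwards [hne] with x hx
  have hx0 : 0 < ‖x‖ := norm_pos_iff.2 hx
  have gen : ∀ a : ℝ, G x ≤ c₂ * ‖x‖ ^ a → ENNReal.ofReal (G x) ^ p ≤ ENNReal.ofReal (c₂ ^ p * ‖x‖ ^ (a * p)) := by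
    intro a ha
    calc ENNReal.ofReal (G x) ^ p ≤ ENNReal.ofReal (c₂ * ‖x‖ ^ a) ^ p := by gcongr
      _ = _ := by
        rw [ENNReal.ofReal_rpow_of_pos (by positivity), mul_rpow hc₂.le (by positivity), ← rpow_mul hx0.le]
  by_cases h1 : ‖x‖ ≤ 1
  · simp only [hh, if_pos h1]; exact gen _ (hGin x hx0 h1)
  · simp only [hh, if_neg h1]; exact gen _ (hGout x (not_le.1 h1).le)

lemma time_aux (θ γ : ℝ) (hθ : -1 < θ) (hθ0 : θ ≤ 0) (t : ℝ) (ht : 2 ≤ t) :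
    ∫⁻ s in Ioc 0 t, ENNReal.ofReal ((t - s) ^ θ * (1 + s) ^ (-γ)) ≤
      ENNReal.ofReal ((t / 2) ^ θ * (∫ s in (0:ℝ)..(t / 2), (1 + s) ^ (-γ)) +
        2 ^ |γ| * t ^ (-γ) * ((t / 2) ^ (θ + 1) / (θ + 1))) := by
  have ht0 : 0 < t := by linarith
  have hsplit : Ioc (0:ℝ) t = Ioc 0 (t / 2) ∪ Ioc (t / 2) t :=
    (Ioc_union_Ioc_eq_Ioc (by linarith) (by linarith)).symm
  have hH : 0 ≤ ∫ s in (0:ℝ)..(t / 2), (1 + s) ^ (-γ) := by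
    apply intervalIntegral.integral_nonneg (by linarith)
    intro s hs
    have := hs.1
    positivity
  rw [hsplit]
  refine (lintegral_union_le _ _ _).trans ?_
  rw [ENNReal.ofReal_add (by positivity) (by
    have : 0 < θ + 1 := by linarith
    positivity)]
  apply add_le_add
  · have hi : IntegrableOn (fun s : ℝ => (1 + s) ^ (-γ)) (Ioc 0 (t / 2)) := by
      rw [← intervalIntegrable_iff_integrableOn_Ioc_of_le (by linarith)]
      apply ContinuousOn.intervalIntegrable
      rw [uIcc_of_le (by linarith)]
      apply ContinuousOn.rpow_const (by fun_prop)
      intro s hs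
      left
      have := hs.1
      linarith
    rw [intervalIntegral.integral_of_le (by linarith), ENNReal.ofReal_mul (by positivity),
      ofReal_integral_eq_lintegral_ofReal hi, ← lintegral_const_mul' _ _ ENNReal.ofReal_ne_top]
    · apply setLIntegral_mono' measurableSet_Ioc
      intro s hs
      have h1 := hs.1
      have h2 := hs.2
      rw [← ENNReal.ofReal_mul (by positivity)]
      apply ENNReal.ofReal_le_ofReal
      apply mul_le_mul_of_nonneg_right _ (by positivity)
      exact rpow_le_rpow_of_nonpos (by positivity) (by linarith) hθ0
    · filter_upwards [ae_restrict_mem measurableSet_Ioc] with s hs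
      have := hs.1
      simp only [Pi.zero_apply]
      positivity
  · have hi0 : IntervalIntegrable (fun s : ℝ => (t - s) ^ θ) volume (t / 2) t := by
      have := (intervalIntegral.intervalIntegrable_rpow' (a := t / 2) (b := 0) hθ).comp_sub_left t
      convert this using 1 <;> ring
    have hi : IntegrableOn (fun s : ℝ => (t - s) ^ θ) (Ioc (t / 2) t) := by
      rwa [← intervalIntegrable_iff_integrableOn_Ioc_of_le (by linarith)]
    have hv : (t / 2) ^ (θ + 1) / (θ + 1) = ∫ s in Ioc (t / 2) t, (t - s) ^ θ := by
      rw [← intervalIntegral.integral_of_le (by linarith),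
        intervalIntegral.integral_comp_sub_left (fun s => s ^ θ) t, integral_rpow (Or.inl hθ)]
      rw [sub_self, zero_rpow (by linarith)]
      ring_nf
    rw [hv, ENNReal.ofReal_mul (by positivity),
      ofReal_integral_eq_lintegral_ofReal hi, ← lintegral_const_mul' _ _ ENNReal.ofReal_ne_top]
    · apply setLIntegral_mono' measurableSet_Ioc
      intro s hs
      have h1 := hs.1
      have h2 := hs.2
      rw [← ENNReal.ofReal_mul (by positivity)]
      apply ENNReal.ofReal_le_ofReal
      rw [mul_comm]
      apply mul_le_mul_of_nonneg_right _ (rpow_nonneg (by linarith) _)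
      rcases le_total 0 γ with hg | hg
      · calc (1 + s) ^ (-γ) ≤ (t / 2) ^ (-γ) :=
              rpow_le_rpow_of_nonpos (by positivity) (by linarith) (by linarith)
          _ = 2 ^ |γ| * t ^ (-γ) := by
              rw [div_rpow ht0.le (by norm_num), abs_of_nonneg hg, rpow_neg (by norm_num : (0:ℝ) ≤ 2)]
              field_simp
      · calc (1 + s) ^ (-γ) ≤ (2 * t) ^ (-γ) :=
              rpow_le_rpow (by linarith) (by linarith) (by linarith)
          _ = 2 ^ |γ| * t ^ (-γ) := by
              rw [mul_rpow (by norm_num) ht0.le, abs_of_nonpos hg]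
    · filter_upwards [ae_restrict_mem measurableSet_Ioc] with s hs
      exact rpow_nonneg (by linarith [hs.2]) _

lemma H_aux (γ t : ℝ) (ht : 2 ≤ t) :
    (γ < 1 → (∫ s in (0:ℝ)..(t / 2), (1 + s) ^ (-γ)) ≤ t ^ (1 - γ) / (1 - γ)) ∧
    (γ = 1 → (∫ s in (0:ℝ)..(t / 2), (1 + s) ^ (-γ)) ≤ Real.log t) ∧
    (1 < γ → (∫ s in (0:ℝ)..(t / 2), (1 + s) ^ (-γ)) ≤ 1 / (γ - 1)) := by
  rw [intervalIntegral.integral_comp_add_left (fun s => s ^ (-γ)) 1]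
  have hnot : (0:ℝ) ∉ uIcc (1 + 0) (1 + t / 2) := by
    rw [uIcc_of_le (by linarith)]
    intro h
    linarith [h.1]
  refine ⟨fun h => ?_, fun h => ?_, fun h => ?_⟩
  · rw [integral_rpow (Or.inl (by linarith))]
    have e : -γ + 1 = 1 - γ := by ring
    rw [e, add_zero, one_rpow]
    have : (1 + t / 2) ^ (1 - γ) ≤ t ^ (1 - γ) := rpow_le_rpow (by linarith) (by linarith) (by linarith)
    apply div_le_div_of_nonneg_right _ (by linarith)
    linarith
  · subst h
    simp_rw [rpow_neg_one]
    rw [integral_inv hnot]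
    apply Real.log_le_log <;> norm_num <;> linarith
  · rw [integral_rpow (Or.inr ⟨by linarith, hnot⟩)]
    have e : -γ + 1 = -(γ - 1) := by ring
    rw [e, add_zero, one_rpow, div_neg, ← neg_div]
    apply div_le_div_of_nonneg_right _ (by linarith)
    have : 0 ≤ (1 + t / 2) ^ (-(γ - 1)) := rpow_nonneg (by linarith) _
    linarith

lemma time_aux2 (θ γ : ℝ) (hθ : -1 < θ) (hθ0 : θ ≤ 0) :
    ∃ C : ℝ, 0 < C ∧ ∀ t : ℝ, 2 ≤ t →
      (γ < 1 → ∫⁻ s in Ioc 0 t, ENNReal.ofReal ((t - s) ^ θ * (1 + s) ^ (-γ)) ≤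
        ENNReal.ofReal (C * t ^ (θ + 1 - γ))) ∧
      (γ = 1 → ∫⁻ s in Ioc 0 t, ENNReal.ofReal ((t - s) ^ θ * (1 + s) ^ (-γ)) ≤
        ENNReal.ofReal (C * t ^ θ * Real.log t)) ∧
      (1 < γ → ∫⁻ s in Ioc 0 t, ENNReal.ofReal ((t - s) ^ θ * (1 + s) ^ (-γ)) ≤
        ENNReal.ofReal (C * t ^ θ)) := by
  have hθ1 : 0 < θ + 1 := by linarith
  have hl2 : 0 < Real.log 2 := Real.log_pos (by norm_num)
  set B : ℝ := 2 ^ |γ| * (1 / 2) ^ (θ + 1) / (θ + 1) with hB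
  have hB0 : 0 < B := by positivity
  set D : ℝ := (1 / 2 : ℝ) ^ θ with hD
  have hD0 : 0 < D := by positivity
  refine ⟨D * (1 + 1 / |γ - 1|) + B * (1 + 1 / Real.log 2), by positivity, fun t ht => ?_⟩
  have ht0 : 0 < t := by linarith
  obtain ⟨H1, H2, H3⟩ := H_aux γ t ht
  have main := time_aux θ γ hθ hθ0 t ht
  have e1 : (t / 2) ^ θ = D * t ^ θ := by
    rw [hD, ← mul_rpow (by norm_num) ht0.le]; ring_nf
  have e2 : 2 ^ |γ| * t ^ (-γ) * ((t / 2) ^ (θ + 1) / (θ + 1)) = B * t ^ (θ + 1 - γ) := by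
    have : (t / 2) ^ (θ + 1) = (1 / 2) ^ (θ + 1) * t ^ (θ + 1) := by
      rw [← mul_rpow (by norm_num) ht0.le]; ring_nf
    rw [this, sub_eq_add_neg (θ + 1), rpow_add ht0 (θ + 1) (-γ), hB]; ring
  rw [e1, e2] at main
  have hT : 0 < t ^ θ := by positivity
  refine ⟨fun h => main.trans (ENNReal.ofReal_le_ofReal ?_),
    fun h => main.trans (ENNReal.ofReal_le_ofReal ?_),
    fun h => main.trans (ENNReal.ofReal_le_ofReal ?_)⟩
  · have hH := H1 h
    have ha : |γ - 1| = 1 - γ := by rw [abs_of_neg (by linarith)]; ring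
    rw [ha]
    have e3 : t ^ (θ + 1 - γ) = t ^ θ * t ^ (1 - γ) := by rw [← rpow_add ht0]; ring_nf
    have hX : 0 < t ^ (1 - γ) := by positivity
    rw [e3]
    calc _ ≤ D * t ^ θ * (t ^ (1 - γ) / (1 - γ)) + B * (t ^ θ * t ^ (1 - γ)) := by gcongr
      _ = (D * (1 / (1 - γ)) + B) * (t ^ θ * t ^ (1 - γ)) := by ring
      _ ≤ _ := by
        apply mul_le_mul_of_nonneg_right _ (by positivity)
        have : 0 < B * (1 / Real.log 2) := by positivity
        nlinarith
  · have hH := H2 h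
    have hlog : Real.log 2 ≤ Real.log t := Real.log_le_log (by norm_num) ht
    have e3 : θ + 1 - γ = θ := by rw [h]; ring
    rw [e3]
    have h1 : 1 ≤ 1 / Real.log 2 * Real.log t := by
      rw [one_div, inv_mul_eq_div, one_le_div hl2]; exact hlog
    calc _ ≤ D * t ^ θ * Real.log t + B * t ^ θ * (1 / Real.log 2 * Real.log t) := by
          apply add_le_add
          · exact mul_le_mul_of_nonneg_left hH (by positivity)
          · exact le_mul_of_one_le_right (by positivity) h1
      _ = (D + B * (1 / Real.log 2)) * t ^ θ * Real.log t := by ring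
      _ ≤ _ := by
        apply mul_le_mul_of_nonneg_right _ (by linarith)
        apply mul_le_mul_of_nonneg_right _ (by positivity)
        have : 0 ≤ D * (1 / |γ - 1|) := by positivity
        nlinarith
  · have hH := H3 h
    have ha : |γ - 1| = γ - 1 := abs_of_pos (by linarith)
    rw [ha]
    have e3 : t ^ (θ + 1 - γ) ≤ t ^ θ :=
      rpow_le_rpow_of_exponent_le (by linarith) (by linarith)
    calc _ ≤ D * t ^ θ * (1 / (γ - 1)) + B * t ^ θ := by gcongr
      _ = (D * (1 / (γ - 1)) + B) * t ^ θ := by ring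
      _ ≤ _ := by
        apply mul_le_mul_of_nonneg_right _ (by positivity)
        have : 0 < B * (1 / Real.log 2) := by positivity
        nlinarith

theorem global_decay_subcritical_range
    (N : ℕ) (α β : ℝ)
    (hα : 0 < α ∧ α < 1) (hβ : 0 < β ∧ β ≤ 1) (hN : 4 * β < (N : ℝ))
    (G : EuclideanSpace ℝ (Fin N) → ℝ)
    (hGmeas : Measurable G) (hGnonneg : ∀ ξ, 0 ≤ G ξ)
    (c₁ c₂ : ℝ) (hc₁ : 0 < c₁) (hc₂ : 0 < c₂)
    (hGin : ∀ ξ : EuclideanSpace ℝ (Fin N), 0 < ‖ξ‖ → ‖ξ‖ ≤ 1 →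
      c₁ * ‖ξ‖ ^ (4 * β - (N : ℝ)) ≤ G ξ ∧ G ξ ≤ c₂ * ‖ξ‖ ^ (4 * β - (N : ℝ)))
    (hGout : ∀ ξ : EuclideanSpace ℝ (Fin N), 1 ≤ ‖ξ‖ →
      c₁ * ‖ξ‖ ^ (-((N : ℝ) + 2 * β)) ≤ G ξ ∧ G ξ ≤ c₂ * ‖ξ‖ ^ (-((N : ℝ) + 2 * β)))
    (Y : EuclideanSpace ℝ (Fin N) → ℝ → ℝ)
    (hY : ∀ x t, Y x t = t ^ (α - 1 - α * (N : ℝ) / (2 * β)) * G ((t ^ (-(α / (2 * β)))) • x))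
    (f : EuclideanSpace ℝ (Fin N) → ℝ → ℝ)
    (hfmeas : Measurable (Function.uncurry f))
    (γ : ℝ) (C₀ : ℝ) (hC₀ : 0 < C₀)
    (hf1 : ∀ t : ℝ, 0 ≤ t →
      eLpNorm (fun y => f y t) 1 volume ≤ ENNReal.ofReal (C₀ * (1 + t) ^ (-γ)))
    (u : EuclideanSpace ℝ (Fin N) → ℝ → ℝ)
    (hu : ∀ x t, u x t = ∫ s in Set.Ioc (0:ℝ) t, ∫ y, Y (x - y) (t - s) * f y s)
(p : ℝ) (hp1 : 1 ≤ p) (hpc : p < (N : ℝ) / ((N : ℝ) - 2 * β)) :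
    ∃ C : ℝ, 0 < C ∧ ∀ t : ℝ, 2 ≤ t →
      (γ < 1 →
        eLpNorm (fun x => u x t) (ENNReal.ofReal p) volume ≤
          ENNReal.ofReal (C * t ^ (-γ + α - (α * (N : ℝ) / (2 * β)) * (1 - 1 / p)))) ∧
      (γ = 1 →
        eLpNorm (fun x => u x t) (ENNReal.ofReal p) volume ≤
          ENNReal.ofReal (C * t ^ (-1 + α - (α * (N : ℝ) / (2 * β)) * (1 - 1 / p)) * Real.log t)) ∧
      (1 < γ →
        eLpNorm (fun x => u x t) (ENNReal.ofReal p) volume ≤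
          ENNReal.ofReal (C * t ^ (-1 + α - (α * (N : ℝ) / (2 * β)) * (1 - 1 / p)))) := by
  obtain ⟨hα0, hα1⟩ := hα
  obtain ⟨hβ0, hβ1⟩ := hβ
  have hN0 : (0 : ℝ) < N := by linarith
  have hp0 : 0 < p := by linarith
  set θ : ℝ := α - 1 - (α * (N : ℝ) / (2 * β)) * (1 - 1 / p) with hθdef
  have hq : 0 ≤ 1 - 1 / p := by
    have : 1 / p ≤ 1 := by rw [div_le_one hp0]; exact hp1
    linarith
  have hθ0 : θ ≤ 0 := by
    have : 0 ≤ (α * (N : ℝ) / (2 * β)) * (1 - 1 / p) := by positivity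
    linarith
  have hθ : -1 < θ := by
    have h1 : p * (N - 2 * β) < N := by rwa [lt_div_iff₀ (by linarith)] at hpc
    have h2 : (N : ℝ) * (1 - 1 / p) < 2 * β := by
      have : (N : ℝ) * (1 - 1 / p) = (N * p - N) / p := by field_simp
      rw [this, div_lt_iff₀ hp0]; linarith
    have h3 : (α * (N : ℝ) / (2 * β)) * (1 - 1 / p) < α := by
      have : (α * (N : ℝ) / (2 * β)) * (1 - 1 / p) = α * ((N : ℝ) * (1 - 1 / p) / (2 * β)) := by ring
      rw [this]
      have h4 : (N : ℝ) * (1 - 1 / p) / (2 * β) < 1 := by rw [div_lt_one (by positivity)]; exact h2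
      nlinarith
    linarith
  set M : ℝ≥0∞ := ∫⁻ x, ENNReal.ofReal (G x) ^ p with hM
  have hMfin : M < ∞ := Gint_aux hβ0 hN G c₂ hc₂ (fun ξ h h' => (hGin ξ h h').2)
    (fun ξ h => (hGout ξ h).2) p hp1 hpc
  -- the basic estimate
  have basic : ∀ t : ℝ, 2 ≤ t → eLpNorm (fun x => u x t) (ENNReal.ofReal p) volume ≤
      M ^ (1 / p) * (ENNReal.ofReal C₀ *
        ∫⁻ s in Ioc 0 t, ENNReal.ofReal ((t - s) ^ θ * (1 + s) ^ (-γ))) := by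
    intro t ht
    set ν : Measure (ℝ × EuclideanSpace ℝ (Fin N)) := (volume.restrict (Ioc 0 t)).prod volume with hν
    set K : EuclideanSpace ℝ (Fin N) → ℝ × EuclideanSpace ℝ (Fin N) → ℝ≥0∞ :=
      fun x z => ENNReal.ofReal (Y (x - z.2) (t - z.1)) with hKdef
    set w : ℝ × EuclideanSpace ℝ (Fin N) → ℝ≥0∞ := fun z => ‖f z.2 z.1‖ₑ with hwdef
    set κ : ℝ × EuclideanSpace ℝ (Fin N) → ℝ≥0∞ := fun z => ENNReal.ofReal ((t - z.1) ^ θ) with hκdef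
    have hKm : Measurable (Function.uncurry K) := by
      change Measurable (fun q : EuclideanSpace ℝ (Fin N) × (ℝ × EuclideanSpace ℝ (Fin N)) =>
        ENNReal.ofReal (Y (q.1 - q.2.2) (t - q.2.1)))
      simp_rw [hY]
      fun_prop
    have hwm : Measurable w := by
      have : Measurable (fun z : ℝ × EuclideanSpace ℝ (Fin N) => f z.2 z.1) :=
        hfmeas.comp measurable_swap
      exact this.enorm
    have hκm : Measurable κ := by fun_prop
    have hlt : ∀ᵐ z ∂ν, 0 < t - z.1 := by
      have h1 : ∀ᵐ s ∂(volume.restrict (Ioc 0 t)), 0 < t - s := by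
        rw [← restrict_Ioo_eq_restrict_Ioc]
        filter_upwards [ae_restrict_mem measurableSet_Ioo] with s hs
        linarith [hs.2]
      exact Measure.quasiMeasurePreserving_fst.ae h1
    have hκ0 : ∀ᵐ z ∂ν, κ z ≠ 0 ∧ κ z ≠ ∞ := by
      filter_upwards [hlt] with z hz
      refine ⟨?_, ENNReal.ofReal_ne_top⟩
      simp only [hκdef, ne_eq, ENNReal.ofReal_eq_zero, not_le]
      positivity
    have hKM : ∀ᵐ z ∂ν, ∫⁻ x, K x z ^ p ≤ M * κ z ^ p := by
      filter_upwards [hlt] with z hz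
      set τ := t - z.1 with hτ
      have e0 : ∀ x, K x z ^ p = ENNReal.ofReal (τ ^ (α - 1 - α * (N : ℝ) / (2 * β))) ^ p *
          ENNReal.ofReal (G ((τ ^ (-(α / (2 * β)))) • (x - z.2))) ^ p := by
        intro x
        simp only [hKdef, hY]
        rw [ENNReal.ofReal_mul (by positivity), ENNReal.mul_rpow_of_nonneg _ _ hp0.le]
      simp_rw [e0]
      rw [lintegral_const_mul _ (by fun_prop),
        scale_aux (fun ξ => ENNReal.ofReal (G ξ) ^ p) (by fun_prop) _ (by positivity) z.2,
        ← mul_assoc, mul_comm, ← hM]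
      apply le_of_eq
      congr 1
      simp only [hκdef]
      rw [ENNReal.ofReal_rpow_of_pos (by positivity), ENNReal.ofReal_rpow_of_pos (by positivity),
        ← ENNReal.ofReal_mul (by positivity), ← rpow_mul hz.le, ← rpow_mul hz.le, ← rpow_mul hz.le,
        ← rpow_add hz]
      congr 2
      rw [hθdef]
      field_simp
      ring
    have mk := mink_aux volume ν K hKm w hwm κ hκm hκ0 p hp1 M hKM
    have hptw : ∀ x, ‖u x t‖ₑ ≤ ∫⁻ z, K x z * w z ∂ν := by
      intro x
      have hKx : Measurable (K x) := hKm.comp (measurable_const.prodMk measurable_id)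
      rw [hν, lintegral_prod _ (by fun_prop), hu]
      refine (enorm_integral_le_lintegral_enorm _).trans ?_
      apply setLIntegral_mono' measurableSet_Ioc
      intro s hs
      refine (enorm_integral_le_lintegral_enorm _).trans ?_
      apply lintegral_mono
      intro y
      simp only [hKdef, hwdef]
      rw [enorm_mul, Real.enorm_of_nonneg]
      rw [hY]
      exact mul_nonneg (rpow_nonneg (by linarith [hs.2]) _) (hGnonneg _)
    have hA : ∫⁻ z, κ z * w z ∂ν ≤ ENNReal.ofReal C₀ *
        ∫⁻ s in Ioc 0 t, ENNReal.ofReal ((t - s) ^ θ * (1 + s) ^ (-γ)) := by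
      rw [hν, lintegral_prod _ (by fun_prop), ← lintegral_const_mul' _ _ ENNReal.ofReal_ne_top]
      apply setLIntegral_mono' measurableSet_Ioc
      intro s hs
      simp only [hκdef, hwdef]
      rw [lintegral_const_mul' _ _ ENNReal.ofReal_ne_top]
      have h1 := hf1 s hs.1.le
      rw [eLpNorm_one_eq_lintegral_enorm] at h1
      have h2 : 0 ≤ (t - s) ^ θ := rpow_nonneg (by linarith [hs.2]) _
      calc _ ≤ ENNReal.ofReal ((t - s) ^ θ) * ENNReal.ofReal (C₀ * (1 + s) ^ (-γ)) := by gcongr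
        _ = _ := by
          rw [← ENNReal.ofReal_mul h2, ← ENNReal.ofReal_mul hC₀.le]
          congr 1; ring
    rw [eLpNorm_eq_lintegral_rpow_enorm_toReal (by simpa using hp0) ENNReal.ofReal_ne_top,
      ENNReal.toReal_ofReal hp0.le]
    calc _ ≤ (M * (∫⁻ z, κ z * w z ∂ν) ^ p) ^ (1 / p) := by
          gcongr
          refine le_trans (lintegral_mono fun x => ?_) mk
          have := hptw x
          gcongr
      _ = M ^ (1 / p) * ∫⁻ z, κ z * w z ∂ν := by
          rw [ENNReal.mul_rpow_of_nonneg _ _ (by positivity), ← ENNReal.rpow_mul]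
          have : p * (1 / p) = 1 := by field_simp
          rw [this, ENNReal.rpow_one]
      _ ≤ _ := by gcongr
  obtain ⟨C, hC, hCt⟩ := time_aux2 θ γ hθ hθ0
  set m : ℝ := (M ^ (1 / p)).toReal with hm
  have hm0 : 0 ≤ m := ENNReal.toReal_nonneg
  have hMm : M ^ (1 / p) ≤ ENNReal.ofReal (m + 1) := by
    rw [← ENNReal.ofReal_toReal (ENNReal.rpow_lt_top_of_nonneg (by positivity) hMfin.ne).ne]
    exact ENNReal.ofReal_le_ofReal (by linarith)
  have fin : ∀ t : ℝ, 2 ≤ t → ∀ X : ℝ,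
      ∫⁻ s in Ioc 0 t, ENNReal.ofReal ((t - s) ^ θ * (1 + s) ^ (-γ)) ≤ ENNReal.ofReal X →
      eLpNorm (fun x => u x t) (ENNReal.ofReal p) volume ≤ ENNReal.ofReal ((m + 1) * (C₀ * X)) := by
    intro t ht X hX
    rw [ENNReal.ofReal_mul (by linarith), ENNReal.ofReal_mul hC₀.le]
    refine (basic t ht).trans ?_
    gcongr
  refine ⟨(m + 1) * (C₀ * C), by positivity, fun t ht => ?_⟩
  obtain ⟨h1, h2, h3⟩ := hCt t ht
  have ea : -γ + α - (α * (N : ℝ) / (2 * β)) * (1 - 1 / p) = θ + 1 - γ := by rw [hθdef]; ring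
  have eb : -1 + α - (α * (N : ℝ) / (2 * β)) * (1 - 1 / p) = θ := by rw [hθdef]; ring
  rw [ea, eb]
  refine ⟨fun h => ?_, fun h => ?_, fun h => ?_⟩
  · have := fin t ht _ (h1 h)
    convert this using 2; ring
  · have := fin t ht _ (h2 h)
    convert this using 2; ring
  · have := fin t ht _ (h3 h)
    convert this using 2; ring
end

section
/- Let p = p_c := N/(N−2β), γ ∈ ℝ, and suppose: ‖f(·,t)‖_{L^1(ℝ^N)} ≤ C₀ (1+t)^{−γ} for all t ≥ 0; there are R₀, C₁ > 0 with |f(x,t)| ≤ C₁ |x|^{−N} (1+t)^{−γ} for all |x| ≥ R₀ and t ≥ 0; and ‖f(·,t)‖_{L^q(ℝ^N)} ≤ C₀ (1+t)^{−γ} for all t ≥ 0, for some q > 1. Then there is a constant C such that the mild solution u satisfies, for all t ≥ 2: ‖u(·,t)‖_{L^{p_c}(ℝ^N)} ≤ C t^{−γ} log t if γ ≤ 1, and ‖u(·,t)‖_{L^{p_c}(ℝ^N)} ≤ C t^{−1} if γ > 1. -/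
open MeasureTheory Real Set Filter
open scoped ENNReal Pointwise

lemma aux_young {E : Type*} [AddCommGroup E] [MeasurableSpace E] [MeasurableAdd₂ E] [MeasurableNeg E]
    [MeasurableSub₂ E]
    (μ : Measure E) [SFinite μ] [μ.IsAddLeftInvariant] [μ.IsNegInvariant]
    (F H : E → ℝ≥0∞) (hF : Measurable F) (hH : Measurable H)
    (a b c : ℝ) (ha : 0 < a) (ha1 : a < 1) (hb : 0 ≤ b) (hc : 0 ≤ c) (habc : a + b + c = 1) :
    ∫⁻ x, (∫⁻ y, F (x - y) ^ (a + b) * H y ^ (a + c) ∂μ) ^ (1 / a) ∂μ ≤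
      ((∫⁻ x, F x ∂μ) ^ (a + b) * (∫⁻ x, H x ∂μ) ^ (a + c)) ^ (1 / a) := by
  have h1a : 0 < 1 - a := by linarith
  have hFx : ∀ x, ∫⁻ y, F (x - y) ∂μ = ∫⁻ y, F y ∂μ := fun x => lintegral_sub_left_eq_self F x
  have hmF : ∀ x, Measurable (fun y => F (x - y)) := fun x => hF.comp (measurable_const.sub measurable_id)
  have key : ∀ x, (∫⁻ y, F (x - y) ^ (a + b) * H y ^ (a + c) ∂μ) ^ (1 / a) ≤
      (∫⁻ y, F (x - y) * H y ∂μ) * ((∫⁻ x, F x ∂μ) ^ (b / a) * (∫⁻ x, H x ∂μ) ^ (c / a)) := by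
    intro x
    have h1 : ∫⁻ y, F (x - y) ^ (a + b) * H y ^ (a + c) ∂μ ≤
        (∫⁻ y, F (x - y) * H y ∂μ) ^ a *
        ((∫⁻ x, F x ∂μ) ^ (b / (1 - a)) * (∫⁻ x, H x ∂μ) ^ (c / (1 - a))) ^ (1 - a) := by
      calc ∫⁻ y, F (x - y) ^ (a + b) * H y ^ (a + c) ∂μ
          = ∫⁻ y, (F (x - y) * H y) ^ a *
            (F (x - y) ^ (b / (1 - a)) * H y ^ (c / (1 - a))) ^ (1 - a) ∂μ := by
            congr 1; ext y
            rw [ENNReal.rpow_add_of_nonneg _ _ ha.le hb, ENNReal.rpow_add_of_nonneg _ _ ha.le hc,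
              ENNReal.mul_rpow_of_nonneg _ _ ha.le, ENNReal.mul_rpow_of_nonneg _ _ h1a.le,
              ← ENNReal.rpow_mul, ← ENNReal.rpow_mul, div_mul_cancel₀ _ h1a.ne',
              div_mul_cancel₀ _ h1a.ne']
            ring
        _ ≤ (∫⁻ y, F (x - y) * H y ∂μ) ^ a *
            (∫⁻ y, (F (x - y) ^ (b / (1 - a)) * H y ^ (c / (1 - a))) ∂μ) ^ (1 - a) := by
            apply ENNReal.lintegral_mul_norm_pow_le _ _ ha.le h1a.le (by ring)
            · exact ((hmF x).mul hH).aemeasurable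
            · exact (((hmF x).pow_const _).mul (hH.pow_const _)).aemeasurable
        _ ≤ _ := by
            gcongr
            rw [← hFx x]
            apply ENNReal.lintegral_mul_norm_pow_le (hmF x).aemeasurable hH.aemeasurable
              (by positivity) (by positivity)
            field_simp; linarith
    calc _ ≤ _ := ENNReal.rpow_le_rpow h1 (by positivity)
      _ = _ := by
        have ha0 : 0 ≤ 1 / a := by positivity
        rw [ENNReal.mul_rpow_of_nonneg _ _ h1a.le, ENNReal.mul_rpow_of_nonneg _ _ ha0,
          ENNReal.mul_rpow_of_nonneg _ _ ha0]
        simp only [← ENNReal.rpow_mul]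
        rw [div_mul_cancel₀ _ h1a.ne', div_mul_cancel₀ _ h1a.ne', mul_one_div_cancel ha.ne',
          ENNReal.rpow_one, mul_one_div, mul_one_div]
  calc _ ≤ ∫⁻ x, (∫⁻ y, F (x - y) * H y ∂μ) *
        ((∫⁻ x, F x ∂μ) ^ (b / a) * (∫⁻ x, H x ∂μ) ^ (c / a)) ∂μ := lintegral_mono key
    _ = (∫⁻ x, ∫⁻ y, F (x - y) * H y ∂μ ∂μ) *
        ((∫⁻ x, F x ∂μ) ^ (b / a) * (∫⁻ x, H x ∂μ) ^ (c / a)) := by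
      rw [lintegral_mul_const]
      apply Measurable.lintegral_prod_right'
        (f := fun z : E × E => F (z.1 - z.2) * H z.2)
      exact (hF.comp (measurable_fst.sub measurable_snd)).mul (hH.comp measurable_snd)
    _ = ((∫⁻ x, F x ∂μ) * (∫⁻ x, H x ∂μ)) *
        ((∫⁻ x, F x ∂μ) ^ (b / a) * (∫⁻ x, H x ∂μ) ^ (c / a)) := by
      congr 1
      rw [lintegral_lintegral_swap]
      · have : ∀ y, ∫⁻ x, F (x - y) * H y ∂μ = (∫⁻ x, F x ∂μ) * H y := by
          intro y
          have hmy : Measurable (fun x => F (x - y)) :=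
            hF.comp (measurable_id.sub measurable_const)
          rw [lintegral_mul_const _ hmy, lintegral_sub_right_eq_self F y]
        simp_rw [this]
        rw [lintegral_const_mul _ hH]
      · exact ((hF.comp (measurable_fst.sub measurable_snd)).mul (hH.comp measurable_snd)).aemeasurable
    _ = _ := by
      have ha0 : 0 ≤ 1 / a := by positivity
      rw [ENNReal.mul_rpow_of_nonneg _ _ ha0]
      simp only [← ENNReal.rpow_mul]
      rw [show (a + b) * (1 / a) = 1 + b / a by field_simp,
        show (a + c) * (1 / a) = 1 + c / a by field_simp,
        ENNReal.rpow_add_of_nonneg _ _ zero_le_one (by positivity),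
        ENNReal.rpow_add_of_nonneg _ _ zero_le_one (by positivity), ENNReal.rpow_one,
        ENNReal.rpow_one]
      ring

/-- Minkowski's integral inequality with explicit majorant. -/
lemma aux_minkowski {E S : Type*} [MeasurableSpace E] [MeasurableSpace S]
    (μ : Measure E) [SFinite μ] (ν : Measure S) [SFinite ν]
    (Z : E → S → ℝ≥0∞) (hZ : Measurable (Function.uncurry Z)) (w : S → ℝ≥0∞) (hw : Measurable w)
    (p : ℝ) (hp : 1 < p)
    (hw0 : ∀ᵐ s ∂ν, w s ≠ 0 ∧ w s ≠ ∞ ∧ ∫⁻ x, Z x s ^ p ∂μ ≤ w s ^ p) :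
    ∫⁻ x, (∫⁻ s, Z x s ∂ν) ^ p ∂μ ≤ (∫⁻ s, w s ∂ν) ^ p := by
  have hp0 : 0 < p := by linarith
  have hip : 0 < 1 / p := by positivity
  have hip1 : 0 ≤ 1 - 1 / p := by
    rw [sub_nonneg, div_le_one hp0]; exact hp.le
  have hZx : ∀ x, Measurable (Z x) := fun x => hZ.comp measurable_prodMk_left
  have hZs : ∀ s, Measurable (fun x => Z x s) := fun x => hZ.comp measurable_prodMk_right
  have key : ∀ x, (∫⁻ s, Z x s ∂ν) ^ p ≤
      (∫⁻ s, Z x s ^ p * w s ^ (1 - p) ∂ν) * (∫⁻ s, w s ∂ν) ^ (p - 1) := by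
    intro x
    have h1 : ∫⁻ s, Z x s ∂ν ≤
        (∫⁻ s, Z x s ^ p * w s ^ (1 - p) ∂ν) ^ (1 / p) * (∫⁻ s, w s ∂ν) ^ (1 - 1 / p) := by
      calc _ = ∫⁻ s, (Z x s ^ p * w s ^ (1 - p)) ^ (1 / p) * w s ^ (1 - 1 / p) ∂ν := by
            apply lintegral_congr_ae
            filter_upwards [hw0] with s hs
            rw [ENNReal.mul_rpow_of_nonneg _ _ hip.le, ← ENNReal.rpow_mul, ← ENNReal.rpow_mul,
              mul_assoc, ← ENNReal.rpow_add _ _ hs.1 hs.2.1, mul_one_div_cancel hp0.ne',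
              show (1 - p) * (1 / p) + (1 - 1 / p) = 0 by field_simp; ring]
            simp
        _ ≤ _ := by
            apply ENNReal.lintegral_mul_norm_pow_le _ hw.aemeasurable hip.le hip1 (by ring)
            exact (((hZx x).pow_const _).mul (hw.pow_const _)).aemeasurable
    calc _ ≤ _ := ENNReal.rpow_le_rpow h1 hp0.le
      _ = _ := by
        rw [ENNReal.mul_rpow_of_nonneg _ _ hp0.le, ← ENNReal.rpow_mul, ← ENNReal.rpow_mul,
          one_div_mul_cancel hp0.ne', ENNReal.rpow_one,
          show (1 - 1 / p) * p = p - 1 by field_simp]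
  have hm : Measurable (fun z : E × S => Z z.1 z.2 ^ p * w z.2 ^ (1 - p)) :=
    (hZ.pow_const p).mul ((hw.comp measurable_snd).pow_const _)
  calc _ ≤ ∫⁻ x, (∫⁻ s, Z x s ^ p * w s ^ (1 - p) ∂ν) * (∫⁻ s, w s ∂ν) ^ (p - 1) ∂μ :=
        lintegral_mono key
    _ = (∫⁻ x, ∫⁻ s, Z x s ^ p * w s ^ (1 - p) ∂ν ∂μ) * (∫⁻ s, w s ∂ν) ^ (p - 1) := by
        rw [lintegral_mul_const]
        exact hm.lintegral_prod_right'
    _ ≤ (∫⁻ s, w s ∂ν) * (∫⁻ s, w s ∂ν) ^ (p - 1) := by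
        gcongr
        rw [lintegral_lintegral_swap hm.aemeasurable]
        apply lintegral_mono_ae
        filter_upwards [hw0] with s hs
        rw [lintegral_mul_const _ ((hZs s).pow_const p)]
        calc _ ≤ w s ^ p * w s ^ (1 - p) := by gcongr; exact hs.2.2
          _ = w s := by
            rw [← ENNReal.rpow_add _ _ hs.1 hs.2.1]; simp
    _ = _ := by
        nth_rewrite 1 [← ENNReal.rpow_one (∫⁻ s, w s ∂ν)]
        rw [← ENNReal.rpow_add_of_nonneg _ _ zero_le_one (by linarith)]
        congr 1; ring

/-- finiteness of the `L^r` norm of the profile -/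
lemma aux_G (N : ℕ) (β : ℝ) (hβ : 0 < β) (hN : 4 * β < (N : ℝ))
    (G : EuclideanSpace ℝ (Fin N) → ℝ) (hGnonneg : ∀ ξ, 0 ≤ G ξ) (c₂ : ℝ) (hc₂ : 0 < c₂)
    (hGin : ∀ ξ : EuclideanSpace ℝ (Fin N), 0 < ‖ξ‖ → ‖ξ‖ ≤ 1 →
      G ξ ≤ c₂ * ‖ξ‖ ^ (4 * β - (N : ℝ)))
    (hGout : ∀ ξ : EuclideanSpace ℝ (Fin N), 1 ≤ ‖ξ‖ →
      G ξ ≤ c₂ * ‖ξ‖ ^ (-((N : ℝ) + 2 * β)))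
    (r : ℝ) (hr : 1 ≤ r) (hr2 : r * (N - 4 * β) < N) :
    ∫⁻ ξ, ENNReal.ofReal (G ξ) ^ r < ∞ := by
  have hN0 : 0 < (N : ℝ) := by linarith
  have hNpos : 0 < N := by exact_mod_cast hN0
  have : Nonempty (Fin N) := ⟨⟨0, hNpos⟩⟩
  have hr0 : 0 < r := by linarith
  let φ : ℝ → ℝ := fun y => if y < 1 then c₂ ^ r * y ^ (r * (4 * β - N)) else
    c₂ ^ r * y ^ (r * (-(N + 2 * β)))
  have hint : Integrable (fun x : EuclideanSpace ℝ (Fin N) => φ ‖x‖) volume := by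
    rw [integrable_fun_norm_addHaar]
    simp only [finrank_euclideanSpace, Fintype.card_fin, smul_eq_mul]
    rw [← Ioo_union_Ici_eq_Ioi (show (0:ℝ) < 1 by norm_num), integrableOn_union]
    have hpow : ∀ y : ℝ, y ^ (N - 1) = y ^ ((N : ℝ) - 1) := by
      intro y
      rw [← Real.rpow_natCast, Nat.cast_sub hNpos]; simp
    constructor
    · have h := ((intervalIntegral.integrableOn_Ioo_rpow_iff (s := (N - 1) + r * (4 * β - N))
        (t := 1) (by norm_num)).2 (by nlinarith)).const_mul (c₂ ^ r)
      refine IntegrableOn.congr_fun h ?_ measurableSet_Ioo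
      intro y hy
      simp only [φ, if_pos hy.2]
      rw [Real.rpow_add hy.1, hpow]; ring
    · rw [integrableOn_Ici_iff_integrableOn_Ioi]
      have h := (integrableOn_Ioi_rpow_of_lt (a := (N - 1) + r * (-(N + 2 * β)))
        (c := 1) (by nlinarith) (by norm_num)).const_mul (c₂ ^ r)
      refine IntegrableOn.congr_fun h ?_ measurableSet_Ioi
      intro y hy
      have hy' : (1:ℝ) < y := hy
      simp only [φ, if_neg (not_lt.2 hy'.le)]
      rw [Real.rpow_add (by linarith), hpow]; ring
  have hfin := hint.hasFiniteIntegral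
  refine lt_of_le_of_lt ?_ hfin
  apply lintegral_mono_ae
  have h0 : ∀ᵐ x : EuclideanSpace ℝ (Fin N), x ≠ 0 := by
    simp [ae_iff, measure_singleton]
  filter_upwards [h0] with x hx
  have hx0 : 0 < ‖x‖ := norm_pos_iff.2 hx
  rw [ENNReal.ofReal_rpow_of_nonneg (hGnonneg x) hr0.le, ← ofReal_norm]
  apply ENNReal.ofReal_le_ofReal
  refine le_trans ?_ (le_abs_self _)
  by_cases h1 : ‖x‖ < 1
  · simp only [φ, if_pos h1]
    calc _ ≤ _ := Real.rpow_le_rpow (hGnonneg x) (hGin x hx0 h1.le) hr0.le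
      _ = _ := by
        rw [Real.mul_rpow hc₂.le (by positivity), ← Real.rpow_mul hx0.le]; ring_nf
  · simp only [φ, if_neg h1]
    calc _ ≤ _ := Real.rpow_le_rpow (hGnonneg x) (hGout x (not_lt.1 h1)) hr0.le
      _ = _ := by
        rw [Real.mul_rpow hc₂.le (by positivity), ← Real.rpow_mul hx0.le]; ring_nf

/-- scaling of the kernel -/
lemma aux_Y (N : ℕ) (G : EuclideanSpace ℝ (Fin N) → ℝ) (hG : Measurable G)
    (e k r t : ℝ) (hr : 0 ≤ r) (ht : 0 < t) :
    ∫⁻ x, (ENNReal.ofReal (t ^ e) * ENNReal.ofReal (G ((t ^ (-k)) • x))) ^ r =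
      ENNReal.ofReal (t ^ (e * r + k * N)) * ∫⁻ x, ENNReal.ofReal (G x) ^ r := by
  have ht1 : 0 < t ^ (-k) := by positivity
  simp_rw [ENNReal.mul_rpow_of_nonneg _ _ hr]
  have hm : Measurable fun x => ENNReal.ofReal (G x) ^ r := hG.ennreal_ofReal.pow_const r
  have hm2 : Measurable fun x => ENNReal.ofReal (G (t ^ (-k) • x)) ^ r :=
    hm.comp (measurable_const_smul _)
  rw [lintegral_const_mul _ hm2]
  have := lintegral_map (μ := volume) hm (measurable_const_smul (t ^ (-k)))
  rw [← this, Measure.map_addHaar_smul _ ht1.ne', lintegral_smul_measure, smul_eq_mul,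
    ← mul_assoc]
  congr 1
  rw [ENNReal.ofReal_rpow_of_nonneg (by positivity) hr, ← ENNReal.ofReal_mul (by positivity),
    abs_of_pos (by positivity)]
  congr 1
  rw [finrank_euclideanSpace, Fintype.card_fin, ← Real.rpow_natCast, ← Real.rpow_mul ht.le,
    ← Real.rpow_mul ht.le, ← Real.rpow_neg ht.le, ← Real.rpow_add ht]
  congr 1; ring

lemma aux_lint (g : ℝ → ℝ) (a b c : ℝ) (hab : a ≤ b) (hg : IntervalIntegrable g volume a b)
    (h0 : ∀ s ∈ Ioc a b, 0 ≤ g s) (hc : ∫ s in a..b, g s ≤ c) :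
    ∫⁻ s in Ioc a b, ENNReal.ofReal (g s) ≤ ENNReal.ofReal c := by
  rw [← ofReal_integral_eq_lintegral_ofReal ((intervalIntegrable_iff_integrableOn_Ioc_of_le hab).1 hg)
    ((ae_restrict_iff' measurableSet_Ioc).2 (Eventually.of_forall h0)),
    ← intervalIntegral.integral_of_le hab]
  exact ENNReal.ofReal_le_ofReal hc

lemma aux_lint_inv (t : ℝ) (ht : 2 ≤ t) :
    ∫⁻ s in Ioc 0 (t / 2), ENNReal.ofReal ((1 + s)⁻¹) ≤ ENNReal.ofReal (Real.log t) := by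
  apply aux_lint _ _ _ _ (by linarith)
  · apply ContinuousOn.intervalIntegrable
    rw [uIcc_of_le (by linarith)]
    intro x hx
    have : (1 + x) ≠ 0 := by linarith [hx.1]
    fun_prop (disch := assumption)
  · intro s hs; have := hs.1; positivity
  · rw [intervalIntegral.integral_comp_add_left (fun x => x⁻¹) 1,
      integral_inv_of_pos (by norm_num) (by linarith)]
    apply Real.log_le_log <;> linarith

lemma aux_lint_pow (γ : ℝ) (hγ : 1 < γ) (t : ℝ) (ht : 2 ≤ t) :
    ∫⁻ s in Ioc 0 (t / 2), ENNReal.ofReal ((1 + s) ^ (-γ)) ≤ ENNReal.ofReal (1 / (γ - 1)) := by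
  apply aux_lint _ _ _ _ (by linarith)
  · apply ContinuousOn.intervalIntegrable
    rw [uIcc_of_le (by linarith)]
    intro x hx
    have : (1 + x) ≠ 0 := by linarith [hx.1]
    apply ContinuousAt.continuousWithinAt
    exact ContinuousAt.rpow_const (by fun_prop) (Or.inl this)
  · intro s hs; have := hs.1; positivity
  · rw [intervalIntegral.integral_comp_add_left (fun x => x ^ (-γ)) 1,
      integral_rpow]
    · have h : 0 ≤ (1 + t / 2) ^ (-γ + 1) := by positivity
      have hγ' : 0 < γ - 1 := by linarith
      have : ((1 + t / 2) ^ (-γ + 1) - (1 + 0) ^ (-γ + 1)) / (-γ + 1) =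
        (1 - (1 + t / 2) ^ (-γ + 1)) / (γ - 1) := by
        rw [show -γ + 1 = -(γ - 1) by ring]
        simp only [add_zero, Real.one_rpow]
        rw [div_neg, ← neg_div]; congr 1; ring
      rw [this]
      gcongr; linarith
    · right
      refine ⟨by linarith, ?_⟩
      rw [uIcc_of_le (by linarith)]
      intro h; linarith [h.1]

lemma aux_lint_near (δ : ℝ) (hδ : 0 < δ) (t : ℝ) :
    ∫⁻ s in Ioc (t - 1) t, ENNReal.ofReal ((t - s) ^ (δ - 1)) ≤ ENNReal.ofReal (1 / δ) := by
  apply aux_lint _ _ _ _ (by linarith)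
  · have h := (intervalIntegral.intervalIntegrable_rpow' (a := 1) (b := 0) (r := δ - 1)
      (by linarith)).comp_sub_left t
    simpa using h
  · intro s hs; have : 0 ≤ t - s := by linarith [hs.2]
    positivity
  · rw [intervalIntegral.integral_comp_sub_left (fun x => x ^ (δ - 1)) t,
      integral_rpow (Or.inl (by linarith))]
    simp [hδ.ne']

lemma aux_lint_mid (t : ℝ) (ht : 2 ≤ t) :
    ∫⁻ s in Ioc (t / 2) (t - 1), ENNReal.ofReal ((t - s)⁻¹) ≤ ENNReal.ofReal (Real.log t) := by
  apply aux_lint _ _ _ _ (by linarith)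
  · apply ContinuousOn.intervalIntegrable
    rw [uIcc_of_le (by linarith)]
    intro x hx
    have : (t - x) ≠ 0 := by linarith [hx.2]
    fun_prop (disch := assumption)
  · intro s hs; have : 0 < t - s := by linarith [hs.2]
    positivity
  · rw [intervalIntegral.integral_comp_sub_left (fun x => x⁻¹) t,
      integral_inv_of_pos (by linarith) (by linarith)]
    apply Real.log_le_log
    · apply div_pos <;> linarith
    · rw [div_le_iff₀ (by linarith)]; linarith

noncomputable def auxH (δ τ : ℝ) : ℝ := if τ < 1 then τ ^ (δ - 1) else τ⁻¹

lemma auxH_meas (δ : ℝ) : Measurable (auxH δ) := by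
  unfold auxH
  exact Measurable.ite measurableSet_Iio (by fun_prop) (by fun_prop)

lemma auxH_pos (δ τ : ℝ) (h : 0 < τ) : 0 < auxH δ τ := by
  unfold auxH; split_ifs <;> positivity

lemma aux_ofReal_mul_lint (S : Set ℝ) (c d : ℝ) (hc : 0 ≤ c) (g : ℝ → ℝ)
    (hg : ∫⁻ s in S, ENNReal.ofReal (g s) ≤ ENNReal.ofReal d) (F : ℝ → ℝ)
    (hS : MeasurableSet S) (hF : ∀ s ∈ S, F s ≤ c * g s) :
    ∫⁻ s in S, ENNReal.ofReal (F s) ≤ ENNReal.ofReal (c * d) := by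
  calc _ ≤ ∫⁻ s in S, ENNReal.ofReal c * ENNReal.ofReal (g s) := by
        apply setLIntegral_mono' hS
        intro s hs
        rw [← ENNReal.ofReal_mul hc]
        exact ENNReal.ofReal_le_ofReal (hF s hs)
    _ = ENNReal.ofReal c * ∫⁻ s in S, ENNReal.ofReal (g s) :=
        lintegral_const_mul' _ _ ENNReal.ofReal_ne_top
    _ ≤ _ := by rw [ENNReal.ofReal_mul hc]; gcongr

lemma aux_ratio (γ t s : ℝ) (ht : 2 ≤ t) (hs : s ∈ Ioc (t / 2) t) :
    (1 + s) ^ (-γ) ≤ 2 ^ |γ| * t ^ (-γ) := by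
  obtain ⟨h1, h2⟩ := hs
  have ht0 : 0 < t := by linarith
  have hs0 : 0 < 1 + s := by linarith
  rcases le_total 0 γ with h | h
  · rw [abs_of_nonneg h]
    have : (2:ℝ) ^ γ * t ^ (-γ) = (t / 2) ^ (-γ) := by
      rw [Real.div_rpow ht0.le (by norm_num), Real.rpow_neg (by norm_num : (0:ℝ) ≤ 2)]
      field_simp
    rw [this]
    apply Real.rpow_le_rpow_of_nonpos <;> linarith
  · rw [abs_of_nonpos h, ← Real.mul_rpow (by norm_num) ht0.le]
    apply Real.rpow_le_rpow <;> linarith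

lemma aux_time (γ δ : ℝ) (hδ : 0 < δ) : ∃ C : ℝ, 0 < C ∧ ∀ t : ℝ, 2 ≤ t →
    (γ ≤ 1 → ∫⁻ s in Ioc 0 t, ENNReal.ofReal ((1 + s) ^ (-γ) * auxH δ (t - s)) ≤
      ENNReal.ofReal (C * t ^ (-γ) * Real.log t)) ∧
    (1 < γ → ∫⁻ s in Ioc 0 t, ENNReal.ofReal ((1 + s) ^ (-γ) * auxH δ (t - s)) ≤
      ENNReal.ofReal (C * t ^ (-1 : ℝ))) := by
  have hl2 : 0 < Real.log 2 := Real.log_pos (by norm_num)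
  set B : ℝ := 1 / (δ * Real.log 2) + 1 with hB
  have hB0 : 0 < B := by positivity
  set D : ℝ := 2 ^ |γ| * B with hD
  have hD0 : 0 < D := by positivity
  have part2 : ∀ t : ℝ, 2 ≤ t →
      ∫⁻ s in Ioc (t / 2) t, ENNReal.ofReal ((1 + s) ^ (-γ) * auxH δ (t - s)) ≤
      ENNReal.ofReal (D * t ^ (-γ) * Real.log t) := by
    intro t ht
    have hlt : Real.log 2 ≤ Real.log t := Real.log_le_log (by norm_num) ht
    have e1 : ∫⁻ s in Ioc (t / 2) t, ENNReal.ofReal (auxH δ (t - s)) ≤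
        ENNReal.ofReal (B * Real.log t) := by
      rw [← Ioc_union_Ioc_eq_Ioc (show t / 2 ≤ t - 1 by linarith) (show t - 1 ≤ t by linarith)]
      refine (lintegral_union_le _ _ _).trans ?_
      have i1 : ∫⁻ s in Ioc (t / 2) (t - 1), ENNReal.ofReal (auxH δ (t - s)) ≤
          ENNReal.ofReal (Real.log t) := by
        refine le_trans ?_ (aux_lint_mid t ht)
        apply setLIntegral_mono' measurableSet_Ioc
        intro s hs
        have : ¬ (t - s < 1) := by linarith [hs.2]
        simp [auxH, this]
      have i2 : ∫⁻ s in Ioc (t - 1) t, ENNReal.ofReal (auxH δ (t - s)) ≤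
          ENNReal.ofReal (1 / δ) := by
        refine le_trans ?_ (aux_lint_near δ hδ t)
        apply setLIntegral_mono' measurableSet_Ioc
        intro s hs
        have : (t - s < 1) := by linarith [hs.1]
        simp [auxH, this]
      refine (add_le_add i1 i2).trans ?_
      rw [← ENNReal.ofReal_add (by linarith) (by positivity)]
      apply ENNReal.ofReal_le_ofReal
      have : 1 / δ ≤ 1 / (δ * Real.log 2) * Real.log t := by
        rw [div_mul_eq_mul_div, div_le_div_iff₀ hδ (by positivity)]
        nlinarith
      rw [hB]; linarith
    have := aux_ofReal_mul_lint (Ioc (t / 2) t) (2 ^ |γ| * t ^ (-γ)) _ (by positivity)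
      (fun s => auxH δ (t - s)) e1 (fun s => (1 + s) ^ (-γ) * auxH δ (t - s)) measurableSet_Ioc ?_
    · convert this using 2; rw [hD]; ring
    · intro s hs
      rcases eq_or_lt_of_le hs.2 with h | h
      · have h0 : 0 ≤ auxH δ (t - s) := by
          subst h; simp only [auxH, sub_self]; split_ifs <;> positivity
        exact mul_le_mul_of_nonneg_right (aux_ratio γ t s ht hs) h0
      · exact mul_le_mul_of_nonneg_right (aux_ratio γ t s ht hs) (auxH_pos _ _ (by linarith)).le
  have split : ∀ t : ℝ, 2 ≤ t → ∀ a b : ℝ, 0 ≤ a → 0 ≤ b →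
      ∫⁻ s in Ioc 0 (t / 2), ENNReal.ofReal ((1 + s) ^ (-γ) * auxH δ (t - s)) ≤
        ENNReal.ofReal a →
      ∫⁻ s in Ioc (t / 2) t, ENNReal.ofReal ((1 + s) ^ (-γ) * auxH δ (t - s)) ≤
        ENNReal.ofReal b →
      ∫⁻ s in Ioc 0 t, ENNReal.ofReal ((1 + s) ^ (-γ) * auxH δ (t - s)) ≤
        ENNReal.ofReal (a + b) := by
    intro t ht a b ha hb h1 h2
    rw [← Ioc_union_Ioc_eq_Ioc (show 0 ≤ t / 2 by linarith) (show t / 2 ≤ t by linarith)]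
    refine (lintegral_union_le _ _ _).trans ?_
    rw [ENNReal.ofReal_add ha hb]
    exact add_le_add h1 h2
  have hHle : ∀ t : ℝ, 2 ≤ t → ∀ s ∈ Ioc 0 (t / 2), auxH δ (t - s) ≤ 2 * t⁻¹ := by
    intro t ht s hs
    have h : ¬ (t - s < 1) := by linarith [hs.2]
    simp only [auxH, if_neg h]
    rw [← div_eq_mul_inv, inv_eq_one_div, div_le_div_iff₀ (by linarith) (by linarith)]
    linarith [hs.2]
  rcases le_or_gt γ 1 with hγ | hγ
  · refine ⟨2 + D, by positivity, fun t ht => ⟨fun _ => ?_, fun h => absurd h (not_lt.2 hγ)⟩⟩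
    have ht0 : 0 < t := by linarith
    have hlt : 0 ≤ Real.log t := Real.log_nonneg (by linarith)
    have p1 := aux_ofReal_mul_lint (Ioc 0 (t / 2)) (2 * t ^ (-γ)) _ (by positivity)
      (fun s => (1 + s)⁻¹) (aux_lint_inv t ht) (fun s => (1 + s) ^ (-γ) * auxH δ (t - s))
      measurableSet_Ioc ?_
    · have := split t ht _ _ (by positivity) (by positivity) p1 (part2 t ht)
      convert this using 2; ring
    · intro s hs
      have hs0 : 0 < 1 + s := by linarith [hs.1]
      have e1 : (1 + s) ^ (-γ) ≤ t ^ (1 - γ) * (1 + s)⁻¹ := by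
        have : (1 + s) ^ (-γ) = (1 + s) ^ (1 - γ) * (1 + s)⁻¹ := by
          rw [show -γ = (1 - γ) + (-1) by ring, Real.rpow_add hs0, Real.rpow_neg_one]
        rw [this]
        gcongr
        linarith [hs.2]
      calc (1 + s) ^ (-γ) * auxH δ (t - s) ≤ (t ^ (1 - γ) * (1 + s)⁻¹) * (2 * t⁻¹) := by
            apply mul_le_mul e1 (hHle t ht s hs) (auxH_pos _ _ (by linarith [hs.2])).le
            positivity
        _ = _ := by
          rw [show -γ = (1 - γ) + (-1) by ring, Real.rpow_add ht0, Real.rpow_neg_one]; ring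
  · have hγ' : 0 < γ - 1 := by linarith
    refine ⟨2 * (1 / (γ - 1)) + D * (1 / (γ - 1)), by positivity, fun t ht =>
      ⟨fun h => absurd h (not_le.2 hγ), fun _ => ?_⟩⟩
    have ht0 : 0 < t := by linarith
    have p1 := aux_ofReal_mul_lint (Ioc 0 (t / 2)) (2 * t⁻¹) _ (by positivity)
      (fun s => (1 + s) ^ (-γ)) (aux_lint_pow γ hγ t ht) (fun s => (1 + s) ^ (-γ) * auxH δ (t - s))
      measurableSet_Ioc ?_
    · have p2 : ∫⁻ s in Ioc (t / 2) t, ENNReal.ofReal ((1 + s) ^ (-γ) * auxH δ (t - s)) ≤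
          ENNReal.ofReal (D * (1 / (γ - 1)) * t⁻¹) := by
        refine (part2 t ht).trans (ENNReal.ofReal_le_ofReal ?_)
        have hl := Real.log_le_rpow_div ht0.le hγ'
        calc D * t ^ (-γ) * Real.log t ≤ D * t ^ (-γ) * (t ^ (γ - 1) / (γ - 1)) := by gcongr
          _ = D * (1 / (γ - 1)) * (t ^ (-γ) * t ^ (γ - 1)) := by ring
          _ = _ := by rw [← Real.rpow_add ht0, show -γ + (γ - 1) = -1 by ring, Real.rpow_neg_one]
      have := split t ht _ _ (by positivity) (by positivity) p1 p2
      convert this using 2; rw [Real.rpow_neg_one]; ring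
    · intro s hs
      have hs0 : 0 < 1 + s := by linarith [hs.1]
      calc _ ≤ (1 + s) ^ (-γ) * (2 * t⁻¹) := by
            gcongr; exact hHle t ht s hs
        _ = _ := by ring

lemma aux_conv (N : ℕ) (α β : ℝ) (hβ : 0 < β) (hN : 4 * β < (N : ℝ))
    (G : EuclideanSpace ℝ (Fin N) → ℝ) (hGmeas : Measurable G) (hGnonneg : ∀ ξ, 0 ≤ G ξ)
    (c₂ : ℝ) (hc₂ : 0 < c₂)
    (hGin : ∀ ξ : EuclideanSpace ℝ (Fin N), 0 < ‖ξ‖ → ‖ξ‖ ≤ 1 →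
      G ξ ≤ c₂ * ‖ξ‖ ^ (4 * β - (N : ℝ)))
    (hGout : ∀ ξ : EuclideanSpace ℝ (Fin N), 1 ≤ ‖ξ‖ →
      G ξ ≤ c₂ * ‖ξ‖ ^ (-((N : ℝ) + 2 * β)))
    (m : ℝ) (hm1 : 1 ≤ m) (hmp : m ≤ (N : ℝ) / (N - 2 * β)) :
    ∃ M : ℝ, 0 < M ∧ ∀ τ : ℝ, 0 < τ → ∀ g : EuclideanSpace ℝ (Fin N) → ℝ≥0∞, Measurable g →
      ∀ A : ℝ≥0∞, ∫⁻ y, g y ^ m ≤ A ^ m →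
      ∫⁻ x, (∫⁻ y, (ENNReal.ofReal (τ ^ (α - 1 - α * (N : ℝ) / (2 * β))) *
        ENNReal.ofReal (G ((τ ^ (-(α / (2 * β)))) • (x - y)))) * g y) ^ ((N : ℝ) / (N - 2 * β)) ≤
      (ENNReal.ofReal (M * τ ^ (α * N / (2 * β) * (1 - 1 / m) - 1)) * A) ^
        ((N : ℝ) / (N - 2 * β)) := by
  have hN0 : 0 < (N : ℝ) := by linarith
  have hN2 : 0 < (N : ℝ) - 2 * β := by linarith
  have hm0 : 0 < m := by linarith
  set a : ℝ := ((N : ℝ) - 2 * β) / N with ha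
  have hpa : (N : ℝ) / (N - 2 * β) = 1 / a := by rw [ha, one_div_div]
  rw [hpa] at hmp ⊢
  have ha0 : 0 < a := by positivity
  have ha1 : a < 1 := by rw [ha, div_lt_one hN0]; linarith
  have him : a ≤ 1 / m := by
    rw [le_div_iff₀ hm0]
    rw [le_div_iff₀ ha0] at hmp; linarith
  have him1 : 1 / m ≤ 1 := by rw [div_le_one hm0]; exact hm1
  set b : ℝ := 1 - 1 / m with hb
  set c : ℝ := 1 / m - a with hc
  have hb0 : 0 ≤ b := by linarith
  have hc0 : 0 ≤ c := by linarith
  have hab : 0 < a + b := by linarith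
  set r : ℝ := 1 / (a + b) with hr
  have hr1 : 1 ≤ r := by rw [hr, le_div_iff₀ hab]; linarith
  have hr0 : 0 < r := by linarith
  have hr2 : r * (N - 4 * β) < N := by
    rw [hr, one_div_mul_eq_div, div_lt_iff₀ hab]
    have : (N : ℝ) * a = N - 2 * β := by rw [ha]; field_simp
    nlinarith
  have hI := aux_G N β hβ hN G hGnonneg c₂ hc₂ hGin hGout r hr1 hr2
  set I := ∫⁻ ξ, ENNReal.ofReal (G ξ) ^ r with hIdef
  have hI' : I ^ (a + b) ≠ ∞ := ENNReal.rpow_ne_top_of_nonneg hab.le hI.ne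
  refine ⟨(I ^ (a + b)).toReal + 1, by positivity, ?_⟩
  intro τ hτ g hg A hA
  set e := α - 1 - α * (N : ℝ) / (2 * β) with he
  set k := α / (2 * β) with hk
  let K : EuclideanSpace ℝ (Fin N) → ℝ≥0∞ := fun x =>
    ENNReal.ofReal (τ ^ e) * ENNReal.ofReal (G ((τ ^ (-k)) • x))
  have hK : Measurable K :=
    measurable_const.mul (hGmeas.comp (measurable_const_smul _)).ennreal_ofReal
  have hy := aux_young volume (fun x => K x ^ r) (fun y => g y ^ m) (hK.pow_const r)
    (hg.pow_const m) a b c ha0 ha1 hb0 hc0 (by rw [hb, hc]; ring)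
  have hrab : r * (a + b) = 1 := by rw [hr]; field_simp
  have hmac : m * (a + c) = 1 := by rw [hc]; field_simp; ring
  have hac : 0 ≤ a + c := by linarith
  simp only [← ENNReal.rpow_mul, hrab, hmac, ENNReal.rpow_one] at hy
  refine hy.trans ?_
  apply ENNReal.rpow_le_rpow _ (by positivity)
  apply mul_le_mul'
  · have := aux_Y N G hGmeas e k r τ hr0.le hτ
    change (∫⁻ x, (ENNReal.ofReal (τ ^ e) * ENNReal.ofReal (G ((τ ^ (-k)) • x))) ^ r) ^ (a + b) ≤ _
    rw [this, ENNReal.mul_rpow_of_nonneg _ _ hab.le, ENNReal.ofReal_rpow_of_pos (by positivity),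
      ← Real.rpow_mul hτ.le, mul_comm ((I ^ (a + b)).toReal + 1),
      ENNReal.ofReal_mul (by positivity)]
    have hexp : (e * r + k * N) * (a + b) = α * N / (2 * β) * b - 1 := by
      calc _ = e * (r * (a + b)) + k * N * (a + b) := by ring
        _ = _ := by
          rw [hrab, he, hk, ha]; field_simp; ring
    rw [hexp]
    gcongr
    rw [← ENNReal.ofReal_toReal hI']
    apply ENNReal.ofReal_le_ofReal
    simp
  · calc (∫⁻ y, g y ^ m) ^ (a + c) ≤ (A ^ m) ^ (a + c) := ENNReal.rpow_le_rpow hA hac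
      _ = A := by rw [← ENNReal.rpow_mul, hmac, ENNReal.rpow_one]

lemma aux_interp {E : Type*} [MeasurableSpace E] (μ : Measure E) (g : E → ℝ≥0∞)
    (hg : Measurable g) (A : ℝ≥0∞) (q m : ℝ) (hm : 1 ≤ m) (hmq : m ≤ q)
    (hq : 1 < q) (h1 : ∫⁻ y, g y ∂μ ≤ A) (h2 : ∫⁻ y, g y ^ q ∂μ ≤ A ^ q) :
    ∫⁻ y, g y ^ m ∂μ ≤ A ^ m := by
  have hq1 : 0 < q - 1 := by linarith
  set b := (m - 1) / (q - 1) with hb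
  have hb0 : 0 ≤ b := div_nonneg (by linarith) hq1.le
  have hb1 : b ≤ 1 := by rw [hb, div_le_one hq1]; linarith
  have hbm : (1 - b) + q * b = m := by
    rw [hb]; field_simp; ring
  have hqb : 0 ≤ q * b := by positivity
  calc ∫⁻ y, g y ^ m ∂μ = ∫⁻ y, g y ^ (1 - b) * (g y ^ q) ^ b ∂μ := by
        congr 1; ext y
        rw [← ENNReal.rpow_mul, ← ENNReal.rpow_add_of_nonneg _ _ (by linarith) hqb, hbm]
    _ ≤ (∫⁻ y, g y ∂μ) ^ (1 - b) * (∫⁻ y, g y ^ q ∂μ) ^ b :=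
        ENNReal.lintegral_mul_norm_pow_le hg.aemeasurable (hg.pow_const q).aemeasurable
          (by linarith) hb0 (by ring)
    _ ≤ A ^ (1 - b) * (A ^ q) ^ b := by
        gcongr
    _ = A ^ m := by
        rw [← ENNReal.rpow_mul, ← ENNReal.rpow_add_of_nonneg _ _ (by linarith) hqb, hbm]

theorem global_decay_critical
    (N : ℕ) (α β : ℝ)
    (hα : 0 < α ∧ α < 1) (hβ : 0 < β ∧ β ≤ 1) (hN : 4 * β < (N : ℝ))
    (G : EuclideanSpace ℝ (Fin N) → ℝ)
    (hGmeas : Measurable G) (hGnonneg : ∀ ξ, 0 ≤ G ξ)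
    (c₁ c₂ : ℝ) (hc₁ : 0 < c₁) (hc₂ : 0 < c₂)
    (hGin : ∀ ξ : EuclideanSpace ℝ (Fin N), 0 < ‖ξ‖ → ‖ξ‖ ≤ 1 →
      c₁ * ‖ξ‖ ^ (4 * β - (N : ℝ)) ≤ G ξ ∧ G ξ ≤ c₂ * ‖ξ‖ ^ (4 * β - (N : ℝ)))
    (hGout : ∀ ξ : EuclideanSpace ℝ (Fin N), 1 ≤ ‖ξ‖ →
      c₁ * ‖ξ‖ ^ (-((N : ℝ) + 2 * β)) ≤ G ξ ∧ G ξ ≤ c₂ * ‖ξ‖ ^ (-((N : ℝ) + 2 * β)))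
    (Y : EuclideanSpace ℝ (Fin N) → ℝ → ℝ)
    (hY : ∀ x t, Y x t = t ^ (α - 1 - α * (N : ℝ) / (2 * β)) * G ((t ^ (-(α / (2 * β)))) • x))
    (f : EuclideanSpace ℝ (Fin N) → ℝ → ℝ)
    (hfmeas : Measurable (Function.uncurry f))
    (γ : ℝ) (C₀ : ℝ) (hC₀ : 0 < C₀)
    (hf1 : ∀ t : ℝ, 0 ≤ t →
      eLpNorm (fun y => f y t) 1 volume ≤ ENNReal.ofReal (C₀ * (1 + t) ^ (-γ)))
    (R₀ C₁ : ℝ) (hR₀ : 0 < R₀) (hC₁ : 0 < C₁)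
    (hfdec : ∀ (x : EuclideanSpace ℝ (Fin N)) (t : ℝ), R₀ ≤ ‖x‖ → 0 ≤ t →
      |f x t| ≤ C₁ * ‖x‖ ^ (-(N : ℝ)) * (1 + t) ^ (-γ))
    (q : ℝ) (hq : 1 < q)
    (hfq : ∀ t : ℝ, 0 ≤ t →
      eLpNorm (fun y => f y t) (ENNReal.ofReal q) volume ≤ ENNReal.ofReal (C₀ * (1 + t) ^ (-γ)))
    (u : EuclideanSpace ℝ (Fin N) → ℝ → ℝ)
    (hu : ∀ x t, u x t = ∫ s in Set.Ioc (0:ℝ) t, ∫ y, Y (x - y) (t - s) * f y s) :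
    ∃ C : ℝ, 0 < C ∧ ∀ t : ℝ, 2 ≤ t →
      (γ ≤ 1 →
        eLpNorm (fun x => u x t) (ENNReal.ofReal ((N : ℝ) / ((N : ℝ) - 2 * β))) volume ≤
          ENNReal.ofReal (C * t ^ (-γ) * Real.log t)) ∧
      (1 < γ →
        eLpNorm (fun x => u x t) (ENNReal.ofReal ((N : ℝ) / ((N : ℝ) - 2 * β))) volume ≤
          ENNReal.ofReal (C * t ^ (-1 : ℝ))) := by
  have hN0 : 0 < (N : ℝ) := by linarith [hβ.1]
  have hN2 : 0 < (N : ℝ) - 2 * β := by linarith [hβ.1]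
  set p : ℝ := (N : ℝ) / ((N : ℝ) - 2 * β) with hp
  have hp1 : 1 < p := by rw [hp, lt_div_iff₀ hN2]; linarith [hβ.1]
  have hp0 : 0 < p := by linarith
  have hGin' : ∀ ξ : EuclideanSpace ℝ (Fin N), 0 < ‖ξ‖ → ‖ξ‖ ≤ 1 →
      G ξ ≤ c₂ * ‖ξ‖ ^ (4 * β - (N : ℝ)) := fun ξ h1 h2 => (hGin ξ h1 h2).2
  have hGout' : ∀ ξ : EuclideanSpace ℝ (Fin N), 1 ≤ ‖ξ‖ →
      G ξ ≤ c₂ * ‖ξ‖ ^ (-((N : ℝ) + 2 * β)) := fun ξ h1 => (hGout ξ h1).2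
  set m : ℝ := min q p with hm
  have hm1 : 1 < m := lt_min hq hp1
  obtain ⟨M₁, hM₁, hconv₁⟩ := aux_conv N α β hβ.1 hN G hGmeas hGnonneg c₂ hc₂ hGin' hGout' 1
    le_rfl hp1.le
  obtain ⟨M₂, hM₂, hconv₂⟩ := aux_conv N α β hβ.1 hN G hGmeas hGnonneg c₂ hc₂ hGin' hGout' m
    hm1.le (min_le_right _ _)
  rw [← hp] at hconv₁ hconv₂
  set δ : ℝ := α * N / (2 * β) * (1 - 1 / m) with hδdef
  have hδ : 0 < δ := by
    have h1 : 1 / m < 1 := by rw [div_lt_one (by linarith)]; exact hm1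
    have h2 : 0 < 1 - 1 / m := by linarith
    have := hα.1
    have := hβ.1
    positivity
  obtain ⟨C, hC, htime⟩ := aux_time γ δ hδ
  set M : ℝ := max M₁ M₂ with hM
  have hM0 : 0 < M := lt_max_of_lt_left hM₁
  have hMC : 0 < M * C₀ := by positivity
  -- bounds for f
  have hfm : ∀ s, Measurable (fun y => ‖f y s‖ₑ) := fun s =>
    (hfmeas.comp measurable_prodMk_right).enorm
  have hA1 : ∀ s : ℝ, 0 ≤ s → ∫⁻ y, ‖f y s‖ₑ ≤ ENNReal.ofReal (C₀ * (1 + s) ^ (-γ)) := by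
    intro s hs
    have := hf1 s hs
    rwa [eLpNorm_one_eq_lintegral_enorm] at this
  have hAq : ∀ s : ℝ, 0 ≤ s → ∫⁻ y, ‖f y s‖ₑ ^ q ≤ ENNReal.ofReal (C₀ * (1 + s) ^ (-γ)) ^ q := by
    intro s hs
    have hq0 : 0 < q := by linarith
    have := hfq s hs
    rw [eLpNorm_eq_lintegral_rpow_enorm_toReal (by simpa using hq0) ENNReal.ofReal_ne_top,
      ENNReal.toReal_ofReal hq0.le] at this
    have h2 := ENNReal.rpow_le_rpow this hq0.le
    rwa [← ENNReal.rpow_mul, one_div_mul_cancel hq0.ne', ENNReal.rpow_one] at h2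
  have hAm : ∀ s : ℝ, 0 ≤ s → ∫⁻ y, ‖f y s‖ₑ ^ m ≤ ENNReal.ofReal (C₀ * (1 + s) ^ (-γ)) ^ m :=
    fun s hs => aux_interp volume _ (hfm s) _ q m hm1.le (min_le_left _ _) hq (hA1 s hs) (hAq s hs)
  have main : ∀ t : ℝ, 2 ≤ t → eLpNorm (fun x => u x t) (ENNReal.ofReal p) volume ≤
      ENNReal.ofReal (M * C₀) *
        ∫⁻ s in Ioc 0 t, ENNReal.ofReal ((1 + s) ^ (-γ) * auxH δ (t - s)) := by
    intro t ht
    let Z : EuclideanSpace ℝ (Fin N) → ℝ → ℝ≥0∞ := fun x s =>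
      ∫⁻ y, (ENNReal.ofReal ((t - s) ^ (α - 1 - α * (N : ℝ) / (2 * β))) *
        ENNReal.ofReal (G (((t - s) ^ (-(α / (2 * β)))) • (x - y)))) * ‖f y s‖ₑ
    have hZ : Measurable (Function.uncurry Z) := by
      apply Measurable.lintegral_prod_right'
        (f := fun z : (EuclideanSpace ℝ (Fin N) × ℝ) × EuclideanSpace ℝ (Fin N) =>
        (ENNReal.ofReal ((t - z.1.2) ^ (α - 1 - α * (N : ℝ) / (2 * β))) *
        ENNReal.ofReal (G (((t - z.1.2) ^ (-(α / (2 * β)))) • (z.1.1 - z.2)))) * ‖f z.2 z.1.2‖ₑ)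
      have h1 : Measurable (fun z : (EuclideanSpace ℝ (Fin N) × ℝ) × EuclideanSpace ℝ (Fin N) =>
        (t - z.1.2)) := by fun_prop
      have h2 : Measurable (fun z : (EuclideanSpace ℝ (Fin N) × ℝ) × EuclideanSpace ℝ (Fin N) =>
        G (((t - z.1.2) ^ (-(α / (2 * β)))) • (z.1.1 - z.2))) := by
        apply hGmeas.comp
        exact (h1.pow_const _).smul (by fun_prop)
      have h3 : Measurable (fun z : (EuclideanSpace ℝ (Fin N) × ℝ) × EuclideanSpace ℝ (Fin N) =>
        f z.2 z.1.2) := by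
        exact hfmeas.comp (measurable_snd.prodMk (measurable_snd.comp measurable_fst))
      exact ((h1.pow_const _).ennreal_ofReal.mul h2.ennreal_ofReal).mul h3.enorm
    have hle : ∀ x, ‖u x t‖ₑ ≤ ∫⁻ s in Ioc 0 t, Z x s := by
      intro x
      rw [hu]
      refine (enorm_integral_le_lintegral_enorm _).trans ?_
      apply setLIntegral_mono' measurableSet_Ioc
      intro s hs
      refine (enorm_integral_le_lintegral_enorm _).trans ?_
      apply lintegral_mono
      intro y
      have hts : 0 ≤ t - s := by linarith [hs.2]
      simp only [hY, enorm_mul]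
      rw [Real.enorm_of_nonneg (Real.rpow_nonneg hts _), Real.enorm_of_nonneg (hGnonneg _)]
    let w : ℝ → ℝ≥0∞ := fun s =>
      ENNReal.ofReal (M * C₀) * ENNReal.ofReal ((1 + s) ^ (-γ) * auxH δ (t - s))
    have hwm : Measurable w := by
      have h1 : Measurable (fun s : ℝ => (1 + s) ^ (-γ) * auxH δ (t - s)) :=
        Measurable.mul (by fun_prop) ((auxH_meas δ).comp (by fun_prop))
      exact h1.ennreal_ofReal.const_mul _
    have hmink := aux_minkowski volume (volume.restrict (Ioc 0 t)) Z hZ w hwm p hp1 ?_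
    · rw [eLpNorm_eq_lintegral_rpow_enorm_toReal (by simpa using hp0) ENNReal.ofReal_ne_top,
        ENNReal.toReal_ofReal hp0.le]
      calc (∫⁻ x, ‖u x t‖ₑ ^ p) ^ (1 / p) ≤ ((∫⁻ s in Ioc 0 t, w s) ^ p) ^ (1 / p) := by
            apply ENNReal.rpow_le_rpow _ (by positivity)
            refine le_trans (lintegral_mono fun x => ?_) hmink
            exact ENNReal.rpow_le_rpow (hle x) hp0.le
        _ = ∫⁻ s in Ioc 0 t, w s := by
            rw [← ENNReal.rpow_mul, mul_one_div_cancel hp0.ne', ENNReal.rpow_one]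
        _ = _ := lintegral_const_mul' _ _ ENNReal.ofReal_ne_top
    · rw [← Measure.restrict_congr_set (Ioo_ae_eq_Ioc (μ := volume) (a := (0:ℝ)) (b := t))]
      rw [ae_restrict_iff' measurableSet_Ioo]
      refine Eventually.of_forall fun s hs => ?_
      have hs0 : 0 < s := hs.1
      have hts : 0 < t - s := by linarith [hs.2]
      have hH := auxH_pos δ _ hts
      refine ⟨?_, ENNReal.mul_ne_top ENNReal.ofReal_ne_top ENNReal.ofReal_ne_top, ?_⟩
      · apply mul_ne_zero
        · simpa using hMC
        · have : 0 < (1 + s) ^ (-γ) * auxH δ (t - s) := by positivity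
          simpa using this
      · by_cases hlt : t - s < 1
        · refine (hconv₂ (t - s) hts _ (hfm s) _ (hAm s hs0.le)).trans ?_
          apply ENNReal.rpow_le_rpow _ hp0.le
          rw [← ENNReal.ofReal_mul (by positivity)]
          simp only [w]
          rw [← ENNReal.ofReal_mul (by positivity)]
          apply ENNReal.ofReal_le_ofReal
          simp only [auxH, if_pos hlt]
          calc _ ≤ M * (t - s) ^ (δ - 1) * (C₀ * (1 + s) ^ (-γ)) := by
                gcongr; exact le_max_right _ _
            _ = _ := by ring
        · have h1 : ∫⁻ y, ‖f y s‖ₑ ^ (1:ℝ) ≤ ENNReal.ofReal (C₀ * (1 + s) ^ (-γ)) ^ (1:ℝ) := by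
            simpa using hA1 s hs0.le
          refine (hconv₁ (t - s) hts _ (hfm s) _ h1).trans ?_
          apply ENNReal.rpow_le_rpow _ hp0.le
          rw [← ENNReal.ofReal_mul (by positivity)]
          simp only [w]
          rw [← ENNReal.ofReal_mul (by positivity)]
          apply ENNReal.ofReal_le_ofReal
          simp only [auxH, if_neg hlt]
          have : α * N / (2 * β) * (1 - 1 / 1) - 1 = -1 := by ring
          rw [this, Real.rpow_neg_one]
          calc _ ≤ M * (t - s)⁻¹ * (C₀ * (1 + s) ^ (-γ)) := by
                gcongr; exact le_max_left _ _
            _ = _ := by ring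
  refine ⟨M * C₀ * C, by positivity, fun t ht => ⟨fun h => ?_, fun h => ?_⟩⟩
  · refine (main t ht).trans ?_
    rw [show M * C₀ * C * t ^ (-γ) * Real.log t = M * C₀ * (C * t ^ (-γ) * Real.log t) by ring,
      ENNReal.ofReal_mul hMC.le]
    gcongr
    exact (htime t ht).1 h
  · refine (main t ht).trans ?_
    rw [show M * C₀ * C * t ^ (-1 : ℝ) = M * C₀ * (C * t ^ (-1 : ℝ)) by ring,
      ENNReal.ofReal_mul hMC.le]
    gcongr
    exact (htime t ht).2 h
end
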